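/- arXiv:2003.00727 — 6 statements merged into one kernel-verified Lean document; each statement's English description precedes it below -/
import Mathlib

section
/- Let Z be a Brown–Resnick stationary random field with values in E satisfying E[Z(t)] = 1 for all t ∈ ℤ^d. Then the limit H_Z = lim_{n→∞} n^{−d} E[max_{t ∈ {0,1,…,n}^d} Z(t)] exists and satisfies H_Z ∈ [0,1]. -/
open MeasureTheory ENNReal Filter
open scoped NNReal ENNReal

/-- Index set `ℤ^d`. -/
abbrev Idx (d : ℕ) := Fin d → ℤ

/-- The space `E = [0,∞)^{ℤ^d}` (with the product σ-field). -/
abbrev Fld (d : ℕ) := Idx d → ℝ≥0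

/-- The shift `B^h`, acting by `(B^h f)(t) = f (t - h)`. -/
def shift {d : ℕ} (h : Idx d) (f : Fld d) : Fld d := fun t => f (t - h)

/-- `F : E → [0,∞]` is 0-homogeneous if `F (c • f) = F f` for all `c > 0`. -/
def Homog0 {d : ℕ} (F : Fld d → ℝ≥0∞) : Prop :=
  ∀ c : ℝ≥0, 0 < c → ∀ f : Fld d, F (fun t => c * f t) = F f

/-- `Z` is a Brown–Resnick stationary random field with unit means: it is measurable,
`E[Z(t)] = 1` for all `t`, and `E[Z(h) F(Z)] = E[Z(0) F(B^h Z)]` for every measurable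
0-homogeneous `F : E → [0,∞]`. -/
structure IsBRS {d : ℕ} {Ω : Type*} [MeasurableSpace Ω] (P : Measure Ω)
    (Z : Ω → Fld d) : Prop where
  meas : Measurable Z
  mean_one : ∀ t : Idx d, ∫⁻ ω, (Z ω t : ℝ≥0∞) ∂P = 1
  tilt_shift : ∀ (h : Idx d) (F : Fld d → ℝ≥0∞), Measurable F → Homog0 F →
    ∫⁻ ω, (Z ω h : ℝ≥0∞) * F (Z ω) ∂P = ∫⁻ ω, (Z ω 0 : ℝ≥0∞) * F (shift h (Z ω)) ∂P

/-- The discrete cube `{0,1,…,n}^d ⊆ ℤ^d`. -/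
def cube (d n : ℕ) : Set (Idx d) := {t | ∀ j, 0 ≤ t j ∧ t j ≤ (n : ℤ)}

/-- `E[max_{t ∈ {0,…,n}^d} Z(t)]`. -/
noncomputable def cubeMaxExp {d : ℕ} {Ω : Type*} [MeasurableSpace Ω] (P : Measure Ω)
    (Z : Ω → Fld d) (n : ℕ) : ℝ≥0∞ :=
  ∫⁻ ω, ⨆ t ∈ cube d n, (Z ω t : ℝ≥0∞) ∂P


/-- Ratio of supremum and sum over the translate `A + h`. -/
noncomputable def ratioF {d : ℕ} (A : Finset (Idx d)) (h : Idx d) (f : Fld d) : ℝ≥0∞ :=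
  (⨆ t ∈ A, (f (t + h) : ℝ≥0∞)) / ∑ t ∈ A, (f (t + h) : ℝ≥0∞)

lemma measurable_ev {d : ℕ} (t : Idx d) : Measurable (fun f : Fld d => (f t : ℝ≥0∞)) :=
  (measurable_pi_apply t).coe_nnreal_ennreal

lemma measurable_supA {d : ℕ} (A : Finset (Idx d)) (h : Idx d) :
    Measurable (fun f : Fld d => ⨆ t ∈ A, (f (t + h) : ℝ≥0∞)) :=
  Measurable.biSup _ (Finset.countable_toSet A) (fun t _ => measurable_ev (t + h))

lemma measurable_ratioF {d : ℕ} (A : Finset (Idx d)) (h : Idx d) : Measurable (ratioF A h) :=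
  (measurable_supA A h).div (Finset.measurable_sum _ (fun t _ => measurable_ev (t + h)))

lemma homog_ratioF {d : ℕ} (A : Finset (Idx d)) (h : Idx d) : Homog0 (ratioF A h) := by
  intro c hc f
  unfold ratioF
  simp only [ENNReal.coe_mul, ← ENNReal.mul_iSup, ← Finset.mul_sum]
  exact ENNReal.mul_div_mul_left _ _ (by simpa using hc.ne') ENNReal.coe_ne_top

lemma sup_eq_sum {d : ℕ} (A : Finset (Idx d)) (h : Idx d) (f : Fld d) :
    (⨆ t ∈ A, (f (t + h) : ℝ≥0∞)) = ∑ s ∈ A, (f (s + h) : ℝ≥0∞) * ratioF A h f := by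
  rw [← Finset.sum_mul]
  unfold ratioF
  symm
  apply ENNReal.mul_div_cancel'
  · intro h0
    rw [Finset.sum_eq_zero_iff] at h0
    simpa using h0
  · intro h1
    exact absurd h1 (by simp [ENNReal.sum_eq_top])

lemma ratioF_shift {d : ℕ} (A : Finset (Idx d)) (h s : Idx d) (f : Fld d) :
    ratioF A h (shift (s + h) f) = ratioF A 0 (shift s f) := by
  unfold ratioF shift
  simp only [add_sub_add_right_eq_sub, add_zero]

lemma sup_shift_aux {d : ℕ} {Ω : Type*} [MeasurableSpace Ω] {P : Measure Ω}
    {Z : Ω → Fld d} (hZ : IsBRS P Z) (A : Finset (Idx d)) (h : Idx d) :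
    ∫⁻ ω, ⨆ t ∈ A, (Z ω (t + h) : ℝ≥0∞) ∂P
      = ∑ s ∈ A, ∫⁻ ω, (Z ω 0 : ℝ≥0∞) * ratioF A 0 (shift s (Z ω)) ∂P := by
  simp_rw [sup_eq_sum]
  rw [lintegral_finsetSum]
  · refine Finset.sum_congr rfl fun s _ => ?_
    rw [hZ.tilt_shift (s + h) _ (measurable_ratioF A h) (homog_ratioF A h)]
    simp_rw [ratioF_shift]
  · intro s _
    exact ((measurable_ev (s + h)).comp hZ.meas).mul ((measurable_ratioF A h).comp hZ.meas)

lemma sup_shift {d : ℕ} {Ω : Type*} [MeasurableSpace Ω] {P : Measure Ω}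
    {Z : Ω → Fld d} (hZ : IsBRS P Z) (A : Finset (Idx d)) (h : Idx d) :
    ∫⁻ ω, ⨆ t ∈ A, (Z ω (t + h) : ℝ≥0∞) ∂P = ∫⁻ ω, ⨆ t ∈ A, (Z ω t : ℝ≥0∞) ∂P := by
  have h0 := sup_shift_aux hZ A 0
  simp only [add_zero] at h0
  rw [sup_shift_aux hZ A h, h0]

/-- The box `{0,…,m-1}^d`. -/
noncomputable def boxF (d m : ℕ) : Finset (Idx d) := Fintype.piFinset fun _ => Finset.Ico (0 : ℤ) m

lemma mem_boxF {d m : ℕ} {t : Idx d} : t ∈ boxF d m ↔ ∀ j, 0 ≤ t j ∧ t j < (m : ℤ) := by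
  simp [boxF]

/-- Expected maximum over the box. -/
noncomputable def gBox {d : ℕ} {Ω : Type*} [MeasurableSpace Ω] (P : Measure Ω)
    (Z : Ω → Fld d) (m : ℕ) : ℝ≥0∞ :=
  ∫⁻ ω, ⨆ t ∈ boxF d m, (Z ω t : ℝ≥0∞) ∂P

lemma gBox_ne_top {d : ℕ} {Ω : Type*} [MeasurableSpace Ω] {P : Measure Ω}
    {Z : Ω → Fld d} (hZ : IsBRS P Z) (m : ℕ) : gBox P Z m ≠ ⊤ := by
  have h1 : gBox P Z m ≤ ∑ t ∈ boxF d m, ∫⁻ ω, (Z ω t : ℝ≥0∞) ∂P := by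
    rw [← lintegral_finsetSum (f := fun t ω => (Z ω t : ℝ≥0∞)) _
      (fun t _ => (measurable_ev t).comp hZ.meas)]
    refine lintegral_mono fun ω => iSup₂_le fun t ht => ?_
    exact Finset.single_le_sum (f := fun t => (Z ω t : ℝ≥0∞)) (fun _ _ => zero_le) ht
  refine ne_top_of_le_ne_top ?_ h1
  simp [hZ.mean_one]

lemma gBox_le_cube {d : ℕ} {Ω : Type*} [MeasurableSpace Ω] (P : Measure Ω)
    (Z : Ω → Fld d) (n : ℕ) : gBox P Z n ≤ cubeMaxExp P Z n := by
  refine lintegral_mono fun ω => iSup₂_le fun t ht => ?_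
  refine le_iSup₂_of_le t ?_ le_rfl
  intro j
  have := mem_boxF.1 ht j
  exact ⟨this.1, this.2.le⟩

lemma gBox_one {d : ℕ} {Ω : Type*} [MeasurableSpace Ω] {P : Measure Ω}
    {Z : Ω → Fld d} (hZ : IsBRS P Z) : gBox P Z 1 ≤ 1 := by
  rw [← hZ.mean_one 0]
  refine lintegral_mono fun ω => iSup₂_le fun t ht => ?_
  have : t = 0 := by
    funext j
    have := mem_boxF.1 ht j
    simp only [Pi.zero_apply]
    push_cast at this
    omega
  rw [this]

lemma cube_le {d : ℕ} {Ω : Type*} [MeasurableSpace Ω] {P : Measure Ω}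
    {Z : Ω → Fld d} (hZ : IsBRS P Z) (n q : ℕ) (hq : 0 < q) :
    cubeMaxExp P Z n ≤ ((n / q + 1 : ℕ) : ℝ≥0∞) ^ d * gBox P Z q := by
  have h1 : cubeMaxExp P Z n ≤
      ∑ s ∈ boxF d (n / q + 1), ∫⁻ ω, ⨆ t ∈ boxF d q, (Z ω (t + fun j => (q : ℤ) * s j) : ℝ≥0∞) ∂P := by
    rw [← lintegral_finsetSum
      (f := fun (s : Idx d) ω => ⨆ t ∈ boxF d q, (Z ω (t + fun j => (q : ℤ) * s j) : ℝ≥0∞)) _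
      (fun s _ => (measurable_supA (boxF d q) (fun j => (q : ℤ) * s j)).comp hZ.meas)]
    refine lintegral_mono fun ω => iSup₂_le fun t ht => ?_
    have hq' : (0 : ℤ) < q := by exact_mod_cast hq
    have hs : (fun j => t j / (q : ℤ)) ∈ boxF d (n / q + 1) := by
      rw [mem_boxF]
      intro j
      refine ⟨Int.ediv_nonneg (ht j).1 hq'.le, ?_⟩
      push_cast
      exact Int.lt_add_one_of_le (Int.ediv_le_ediv hq' (ht j).2)
    refine le_trans ?_ (Finset.single_le_sum
      (f := fun s : Idx d => ⨆ t ∈ boxF d q, (Z ω (t + fun j => (q : ℤ) * s j) : ℝ≥0∞))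
      (fun _ _ => zero_le) hs)
    refine le_iSup₂_of_le (fun j => t j % (q : ℤ)) ?_ ?_
    · rw [mem_boxF]
      exact fun j => ⟨Int.emod_nonneg _ hq'.ne', Int.emod_lt_of_pos _ hq'⟩
    · have : ((fun j => t j % (q : ℤ)) + fun j => (q : ℤ) * (t j / (q : ℤ))) = t := by
        funext j
        exact Int.emod_add_mul_ediv _ _
      rw [this]
  refine h1.trans (le_of_eq ?_)
  simp_rw [sup_shift hZ]
  rw [Finset.sum_const, nsmul_eq_mul]
  have : (boxF d (n / q + 1)).card = (n / q + 1) ^ d := by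
    simp only [boxF, Fintype.card_piFinset, Int.card_Ico, Finset.prod_const, Finset.card_univ,
      Fintype.card_fin]
    congr 1
  rw [this, Nat.cast_pow]
  rfl

lemma upper {d : ℕ} {Ω : Type*} [MeasurableSpace Ω] {P : Measure Ω}
    {Z : Ω → Fld d} (hZ : IsBRS P Z) (n q : ℕ) (hn : 0 < n) (hq : 0 < q) :
    cubeMaxExp P Z n / (n : ℝ≥0∞) ^ d ≤ ((q : ℝ≥0∞)⁻¹ + (n : ℝ≥0∞)⁻¹) ^ d * gBox P Z q := by
  have hn0 : (n : ℝ≥0∞) ≠ 0 := by exact_mod_cast hn.ne'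
  have hq0 : (q : ℝ≥0∞) ≠ 0 := by exact_mod_cast hq.ne'
  have hnt : (n : ℝ≥0∞) ≠ ⊤ := ENNReal.natCast_ne_top n
  rw [ENNReal.div_le_iff (pow_ne_zero _ hn0) (ENNReal.pow_ne_top hnt)]
  refine (cube_le hZ n q hq).trans ?_
  rw [mul_right_comm, ← mul_pow]
  gcongr
  rw [add_mul, ENNReal.inv_mul_cancel hn0 hnt]
  push_cast
  gcongr
  rw [mul_comm, ← div_eq_mul_inv, ENNReal.le_div_iff_mul_le (Or.inl hq0)
    (Or.inl (ENNReal.natCast_ne_top q))]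
  exact_mod_cast Nat.div_mul_le_self n q

/-- For a Brown–Resnick stationary random field `Z` with `E[Z(t)] = 1`,
the Pickands constant `H_Z = lim_{n→∞} n^{-d} E[max_{t∈{0,…,n}^d} Z(t)]` exists and lies
in `[0,1]`. -/
theorem stmt0 {d : ℕ} (hd : 0 < d) {Ω : Type*} [MeasurableSpace Ω] (P : Measure Ω)
    [IsProbabilityMeasure P] (Z : Ω → Fld d) (hZ : IsBRS P Z) :
    ∃ H : ℝ≥0∞, H ≤ 1 ∧
      Tendsto (fun n : ℕ => cubeMaxExp P Z n / (n : ℝ≥0∞) ^ d) atTop (nhds H) := by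
  refine ⟨⨅ q : ℕ, ⨅ _ : 0 < q, gBox P Z q / (q : ℝ≥0∞) ^ d, ?_, ?_⟩
  · refine iInf₂_le_of_le 1 one_pos ?_
    simpa using gBox_one hZ
  · rw [tendsto_order]
    constructor
    · intro a ha
      filter_upwards [eventually_gt_atTop 0] with n hn
      refine ha.trans_le ((iInf₂_le n hn).trans ?_)
      gcongr
      exact gBox_le_cube P Z n
    · intro b hb
      simp only [iInf_lt_iff] at hb
      obtain ⟨q, hq, hqb⟩ := hb
      have hT : Tendsto (fun n : ℕ => ((q : ℝ≥0∞)⁻¹ + (n : ℝ≥0∞)⁻¹) ^ d * gBox P Z q) atTop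
          (nhds (((q : ℝ≥0∞)⁻¹ + 0) ^ d * gBox P Z q)) := by
        refine ENNReal.Tendsto.mul_const ?_ (Or.inr (gBox_ne_top hZ q))
        exact ((ENNReal.continuous_pow d).tendsto _).comp
          (tendsto_const_nhds.add ENNReal.tendsto_inv_nat_nhds_zero)
      have hlt : ((q : ℝ≥0∞)⁻¹ + 0) ^ d * gBox P Z q < b := by
        rw [add_zero, ← ENNReal.inv_pow, mul_comm, ← div_eq_mul_inv]
        exact hqb
      filter_upwards [eventually_gt_atTop 0, hT.eventually (gt_mem_nhds hlt)] with n hn h2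
      exact (upper hZ n q hn hq).trans_lt h2
end

section
/- Let Z be a measurable random field with values in E satisfying E[Z(t)] = 1 for all t ∈ ℤ^d, and let X be a real random field on ℤ^d whose finite-dimensional distributions satisfy P(X(t₁) ≤ x₁, …, X(t_n) ≤ x_n) = exp(−E[max_{1≤i≤n} Z(t_i)/x_i]) for all n ≥ 1, t₁,…,t_n ∈ ℤ^d and x₁,…,x_n ∈ (0,∞). Then for every h ∈ ℤ^d, t₁,…,t_n ∈ ℤ^d and x₁,…,x_n ∈ (0,∞), lim_{u→∞} P(X(t₁) ≤ u x₁, …, X(t_n) ≤ u x_n | X(h) > u) = E[max(Z(h), max_{1≤i≤n} Z(t_i)/x_i) − max_{1≤i≤n} Z(t_i)/x_i], and equivalently lim_{u→∞} u·P(X(t₁) ≤ u x₁, …, X(t_n) ≤ u x_n, X(h) > u) equals the same expectation. -/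
open MeasureTheory ENNReal Filter
open scoped NNReal ENNReal

lemma aux_lim (c : ℝ) : Tendsto (fun u : ℝ => u * (1 - Real.exp (-(c / u)))) atTop (nhds c) := by
  have h1 : HasDerivAt (fun v : ℝ => 1 - Real.exp (-(c * v))) c 0 := by
    have := ((((hasDerivAt_id (0:ℝ)).const_mul c).neg).exp).const_sub 1
    simpa using this
  have h2 := h1.tendsto_slope_zero_right
  have h3 := h2.comp tendsto_inv_atTop_nhdsGT_zero
  refine h3.congr fun u => ?_
  simp [div_eq_mul_inv]

lemma aux_iSup {n : ℕ} (f : Fin (n + 1) → ℝ≥0∞) : ⨆ i, f i = max (f 0) (⨆ i : Fin n, f i.succ) := by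
  apply le_antisymm
  · refine iSup_le fun i => ?_
    refine Fin.cases ?_ (fun j => ?_) i
    · exact le_max_left _ _
    · exact le_max_of_le_right (le_iSup (fun i : Fin n => f i.succ) j)
  · exact max_le (le_iSup f 0) (iSup_le fun j => le_iSup f j.succ)

lemma aux_scale {d : ℕ} {Ω : Type*} [MeasurableSpace Ω] (P : Measure Ω)
    (Z : Ω → Fld d) (X : Ω → Idx d → ℝ)
    (hfidi : ∀ (n : ℕ) (t : Fin n → Idx d) (x : Fin n → ℝ≥0), (∀ i, 0 < x i) →
      P {ω | ∀ i, X ω (t i) ≤ (x i : ℝ)} =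
        ENNReal.ofReal
          (Real.exp (-(∫⁻ ω, ⨆ i, (Z ω (t i) : ℝ≥0∞) / (x i : ℝ≥0∞) ∂P).toReal)))
    (n : ℕ) (t : Fin n → Idx d) (x : Fin n → ℝ≥0)
    (hx : ∀ i, 0 < x i) (u : ℝ) (hu : 0 < u) :
    P {ω | ∀ i, X ω (t i) ≤ u * (x i : ℝ)} =
      ENNReal.ofReal
        (Real.exp (-((∫⁻ ω, ⨆ i, (Z ω (t i) : ℝ≥0∞) / (x i : ℝ≥0∞) ∂P).toReal / u))) := by
  lift u to ℝ≥0 using hu.le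
  have hu' : 0 < u := by exact_mod_cast hu
  have h0 := hfidi n t (fun i => u * x i) (fun i => mul_pos hu' (hx i))
  simp only [NNReal.coe_mul] at h0
  rw [h0]
  have : ∀ ω, (⨆ i, (Z ω (t i) : ℝ≥0∞) / ((u * x i : ℝ≥0) : ℝ≥0∞))
      = (u : ℝ≥0∞)⁻¹ * ⨆ i, (Z ω (t i) : ℝ≥0∞) / (x i : ℝ≥0∞) := by
    intro ω
    rw [ENNReal.mul_iSup]
    congr 1; ext1 i
    rw [ENNReal.coe_mul, div_eq_mul_inv, div_eq_mul_inv,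
      ENNReal.mul_inv (Or.inr ENNReal.coe_ne_top) (Or.inl ENNReal.coe_ne_top)]
    ring
  simp_rw [this]
  rw [lintegral_const_mul' _ _ (by simp [hu'.ne']), ENNReal.toReal_mul]
  simp [div_eq_mul_inv, mul_comm]

/-- Let `Z` be a measurable random field with `E[Z(t)] = 1`, and let `X`
be a (max-stable) random field whose finite-dimensional distributions are
`P(X(t₁) ≤ x₁, …, X(tₙ) ≤ xₙ) = exp(-E[max_i Z(tᵢ)/xᵢ])`.  Then for every `h`, `tᵢ`,
`xᵢ > 0`, as `u → ∞`,
`P(X(t₁) ≤ u x₁, …, X(tₙ) ≤ u xₙ | X(h) > u) → E[max(Z(h), max_i Z(tᵢ)/xᵢ) - max_i Z(tᵢ)/xᵢ]`,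
and equivalently `u · P(X(t₁) ≤ u x₁, …, X(tₙ) ≤ u xₙ, X(h) > u)` converges to the same
expectation. -/
theorem stmt2 {d : ℕ} (hd : 0 < d) {Ω : Type*} [MeasurableSpace Ω] (P : Measure Ω)
    [IsProbabilityMeasure P] (Z : Ω → Fld d) (hZmeas : Measurable Z)
    (hmean : ∀ t : Idx d, ∫⁻ ω, (Z ω t : ℝ≥0∞) ∂P = 1)
    (X : Ω → Idx d → ℝ) (hXmeas : ∀ t, Measurable fun ω => X ω t)
    (hfidi : ∀ (n : ℕ) (t : Fin n → Idx d) (x : Fin n → ℝ≥0), (∀ i, 0 < x i) →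
      P {ω | ∀ i, X ω (t i) ≤ (x i : ℝ)} =
        ENNReal.ofReal
          (Real.exp (-(∫⁻ ω, ⨆ i, (Z ω (t i) : ℝ≥0∞) / (x i : ℝ≥0∞) ∂P).toReal)))
    (h : Idx d) (n : ℕ) (hn : 0 < n) (t : Fin n → Idx d) (x : Fin n → ℝ≥0)
    (hx : ∀ i, 0 < x i) :
    Tendsto
      (fun u : ℝ =>
        P {ω | (∀ i, X ω (t i) ≤ u * (x i : ℝ)) ∧ u < X ω h} / P {ω | u < X ω h})
      atTop
      (nhds (∫⁻ ω, (max (Z ω h : ℝ≥0∞) (⨆ i, (Z ω (t i) : ℝ≥0∞) / (x i : ℝ≥0∞)) -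
        ⨆ i, (Z ω (t i) : ℝ≥0∞) / (x i : ℝ≥0∞)) ∂P)) ∧
    Tendsto
      (fun u : ℝ =>
        ENNReal.ofReal u * P {ω | (∀ i, X ω (t i) ≤ u * (x i : ℝ)) ∧ u < X ω h})
      atTop
      (nhds (∫⁻ ω, (max (Z ω h : ℝ≥0∞) (⨆ i, (Z ω (t i) : ℝ≥0∞) / (x i : ℝ≥0∞)) -
        ⨆ i, (Z ω (t i) : ℝ≥0∞) / (x i : ℝ≥0∞)) ∂P)) := by
  set M : Ω → ℝ≥0∞ := fun ω => ⨆ i, (Z ω (t i) : ℝ≥0∞) / (x i : ℝ≥0∞) with hM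
  have hZt : ∀ t, Measurable fun ω => (Z ω t : ℝ≥0∞) := fun t =>
    ((measurable_pi_apply t).comp hZmeas).coe_nnreal_ennreal
  have hMm : Measurable M := Measurable.iSup fun i => (hZt (t i)).div_const _
  have hMfin : ∫⁻ ω, M ω ∂P ≠ ∞ := by
    have hle : ∫⁻ ω, M ω ∂P ≤ ∫⁻ ω, ∑ i, (Z ω (t i) : ℝ≥0∞) / (x i : ℝ≥0∞) ∂P :=
      lintegral_mono fun ω => iSup_le fun i =>
        Finset.single_le_sum (f := fun i => (Z ω (t i) : ℝ≥0∞) / (x i : ℝ≥0∞))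
          (fun _ _ => zero_le) (Finset.mem_univ i)
    refine ne_top_of_le_ne_top ?_ hle
    rw [lintegral_finsetSum _ fun i _ => (hZt (t i)).div_const _]
    refine (ENNReal.sum_lt_top.2 fun i _ => ?_).ne
    simp_rw [div_eq_mul_inv]
    rw [lintegral_mul_const _ (hZt (t i)), hmean, one_mul]
    simp [(hx i)]
  have hBfin : ∫⁻ ω, max (Z ω h : ℝ≥0∞) (M ω) ∂P ≠ ∞ := by
    have hle : ∫⁻ ω, max (Z ω h : ℝ≥0∞) (M ω) ∂P ≤ ∫⁻ ω, ((Z ω h : ℝ≥0∞) + M ω) ∂P :=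
      lintegral_mono fun ω => max_le le_self_add le_add_self
    refine ne_top_of_le_ne_top ?_ hle
    rw [lintegral_add_left (hZt h), hmean]
    simp [hMfin]
  have hsub : ∫⁻ ω, (max (Z ω h : ℝ≥0∞) (M ω) - M ω) ∂P
      = ENNReal.ofReal ((∫⁻ ω, max (Z ω h : ℝ≥0∞) (M ω) ∂P).toReal - (∫⁻ ω, M ω ∂P).toReal) := by
    rw [lintegral_sub hMm hMfin (Eventually.of_forall fun ω => le_max_right _ _),
      ENNReal.ofReal_sub _ ENNReal.toReal_nonneg, ENNReal.ofReal_toReal hMfin,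
      ENNReal.ofReal_toReal hBfin]
  have hA := fun u hu => aux_scale P Z X hfidi n t x hx u hu
  have hB := fun u hu => aux_scale P Z X hfidi (n + 1) (Fin.cons h t) (Fin.cons 1 x)
    (fun i => Fin.cases (by simp) (fun j => by simpa using hx j) i) u hu
  have hC := fun u hu => aux_scale P Z X hfidi 1 (fun _ => h) (fun _ => 1)
    (fun i => one_pos) u hu
  simp only [Fin.forall_fin_succ, aux_iSup, Fin.cons_zero, Fin.cons_succ, NNReal.coe_one, mul_one,
    ENNReal.coe_one, div_one] at hB
  simp only [forall_const, NNReal.coe_one, mul_one, ENNReal.coe_one, div_one, ciSup_const,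
    hmean, ENNReal.toReal_one] at hC
  rw [hsub]
  change ∀ u : ℝ, 0 < u → _ = ENNReal.ofReal (Real.exp (-((∫⁻ ω, M ω ∂P).toReal / u))) at hA
  change ∀ u : ℝ, 0 < u → _ = ENNReal.ofReal (Real.exp
    (-((∫⁻ ω, max (Z ω h : ℝ≥0∞) (M ω) ∂P).toReal / u))) at hB
  generalize (∫⁻ ω, M ω ∂P).toReal = a at *
  generalize (∫⁻ ω, max (Z ω h : ℝ≥0∞) (M ω) ∂P).toReal = b at *
  have hN : ∀ u : ℝ, 0 < u → P {ω | (∀ i, X ω (t i) ≤ u * (x i : ℝ)) ∧ u < X ω h}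
      = ENNReal.ofReal (Real.exp (-(a / u)) - Real.exp (-(b / u))) := by
    intro u hu
    have hms : MeasurableSet {ω | X ω h ≤ u ∧ ∀ i, X ω (t i) ≤ u * (x i : ℝ)} := by
      have he : {ω | X ω h ≤ u ∧ ∀ i, X ω (t i) ≤ u * (x i : ℝ)}
          = {ω | X ω h ≤ u} ∩ ⋂ i, {ω | X ω (t i) ≤ u * (x i : ℝ)} := by
        ext ω
        simp
      rw [he]
      exact (measurableSet_le (hXmeas h) measurable_const).inter
        (MeasurableSet.iInter fun i => measurableSet_le (hXmeas _) measurable_const)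
    have hss : {ω | X ω h ≤ u ∧ ∀ i, X ω (t i) ≤ u * (x i : ℝ)}
        ⊆ {ω | ∀ i, X ω (t i) ≤ u * (x i : ℝ)} := fun ω hω => hω.2
    rw [ENNReal.ofReal_sub _ (Real.exp_pos _).le, ← hA u hu, ← hB u hu,
      ← measure_sdiff hss hms.nullMeasurableSet (measure_ne_top _ _)]
    congr 1
    ext ω
    simp only [Set.mem_setOf_eq, Set.mem_sdiff, not_and, ← not_le]
    tauto
  have hD : ∀ u : ℝ, 0 < u → P {ω | u < X ω h} = ENNReal.ofReal (1 - Real.exp (-(1 / u))) := by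
    intro u hu
    rw [ENNReal.ofReal_sub _ (Real.exp_pos _).le, ← hC u hu, ENNReal.ofReal_one,
      ← prob_compl_eq_one_sub (measurableSet_le (hXmeas h) measurable_const)]
    congr 1
    ext ω
    simp
  have hlimN : Tendsto (fun u : ℝ =>
      ENNReal.ofReal u * P {ω | (∀ i, X ω (t i) ≤ u * (x i : ℝ)) ∧ u < X ω h})
      atTop (nhds (ENNReal.ofReal (b - a))) := by
    refine (ENNReal.tendsto_ofReal ((aux_lim b).sub (aux_lim a))).congr' ?_
    filter_upwards [eventually_gt_atTop 0] with u hu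
    rw [hN u hu, ← ENNReal.ofReal_mul hu.le]
    congr 1
    ring
  have hlimD : Tendsto (fun u : ℝ => ENNReal.ofReal u * P {ω | u < X ω h})
      atTop (nhds 1) := by
    rw [← ENNReal.ofReal_one]
    refine (ENNReal.tendsto_ofReal (aux_lim 1)).congr' ?_
    filter_upwards [eventually_gt_atTop 0] with u hu
    rw [hD u hu, ← ENNReal.ofReal_mul hu.le]
  refine ⟨?_, hlimN⟩
  have hdiv := ENNReal.Tendsto.div hlimN (Or.inr one_ne_zero) hlimD (Or.inl ENNReal.one_ne_top)
  rw [div_one] at hdiv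
  refine hdiv.congr' ?_
  filter_upwards [eventually_gt_atTop 0] with u hu
  exact ENNReal.mul_div_mul_left _ _ (by simpa using hu) ENNReal.ofReal_ne_top
end

section
/- Let Θ* be a random field with values in E satisfying the tilt-shift identity, let R be a unit Pareto random variable (P(R > x) = 1/x, x ≥ 1) independent of Θ*, and set Y(t) = R·Θ*(t). Let p : ℤ^d → (0,1) satisfy Σ_{j∈ℤ^d} p_j = 1 and let N be a random variable with P(N = j) = p_j, independent of (R, Θ*). Define I_A(g) = min{ i ∈ ℤ^d : p_i g(i) = max_{j∈ℤ^d} p_j g(j) } (minimum with respect to the lexicographic order on ℤ^d) and Z_N(t) = ((B^N Y)(t) / max_{i∈ℤ^d} p_i (B^N Y)(i)) · 1{ I_A(B^N Y weighted by p) = N }, i.e. Z_N(t) = (B^N Y)(t)/(max_i p_i (B^N Y)(i)) on the event that the first (lexicographic) maximizer of i ↦ p_i (B^N Y)(i) equals N, and Z_N(t) = 0 otherwise. Then Z_N is well defined almost surely, and for all a, h ∈ ℤ^d and every measurable 0-homogeneous F : E → [0,∞], E[Z_N(h) F(B^a Z_N)] = E[F(B^{a+h} Θ*)] = E[Z_N(a)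 F(B^h Z_N)]. In particular Z_N is Brown–Resnick stationary with E[Z_N(t)] = 1 for all t, and its spectral tail field has the same law as Θ*. -/
open MeasureTheory ENNReal Filter
open scoped NNReal ENNReal Classical

/-- `Θ` satisfies the tilt-shift identity: `Θ(0) = 1` a.s. and
`E[Θ(h) F(Θ)] = E[F(B^h Θ) 1{Θ(-h) ≠ 0}]` for every measurable 0-homogeneous `F`. -/
def TiltShiftId {d : ℕ} {Ω : Type*} [MeasurableSpace Ω] (P : Measure Ω)
    (Θ : Ω → Fld d) : Prop :=
  Measurable Θ ∧ (∀ᵐ ω ∂P, Θ ω 0 = 1) ∧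
  ∀ (h : Idx d) (F : Fld d → ℝ≥0∞), Measurable F → Homog0 F →
    ∫⁻ ω, (Θ ω h : ℝ≥0∞) * F (Θ ω) ∂P = ∫⁻ ω in {ω | Θ ω (-h) ≠ 0}, F (shift h (Θ ω)) ∂P

/-- `R` is a unit Pareto random variable: `P(R > x) = 1/x` for `x ≥ 1`. -/
def IsUnitPareto {Ω : Type*} [MeasurableSpace Ω] (P : Measure Ω) (R : Ω → ℝ≥0) : Prop :=
  Measurable R ∧ ∀ x : ℝ, 1 ≤ x → P {ω | x < (R ω : ℝ)} = ENNReal.ofReal x⁻¹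

/-- Lexicographic order on `ℤ^d`. -/
def lexLe {d : ℕ} (a b : Idx d) : Prop :=
  a = b ∨ ∃ j, (∀ k, k < j → a k = b k) ∧ a j < b j

/-- `j` is the first (lexicographic) maximizer of `g : ℤ^d → [0,∞]`. -/
def IsFirstMaxAt {d : ℕ} (g : Idx d → ℝ≥0∞) (j : Idx d) : Prop :=
  (∀ i, g i ≤ g j) ∧ ∀ i, (∀ k, g k ≤ g i) → lexLe j i

/-- The random field `Z_N(t) = (B^N Y)(t) / max_i p_i (B^N Y)(i)` on the event that the
first lexicographic maximizer of `i ↦ p_i (B^N Y)(i)` equals `N`, and `0` otherwise,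
where `Y(t) = R·Θ(t)`. -/
noncomputable def ZN {d : ℕ} {Ω : Type*} (p : Idx d → ℝ≥0) (N : Ω → Idx d)
    (R : Ω → ℝ≥0) (Θ : Ω → Fld d) (ω : Ω) : Fld d := fun t =>
  if IsFirstMaxAt (fun i => (p i : ℝ≥0∞) * ((R ω * Θ ω (i - N ω) : ℝ≥0) : ℝ≥0∞)) (N ω)
  then (((R ω * Θ ω (t - N ω) : ℝ≥0) : ℝ≥0∞) /
      ⨆ i, (p i : ℝ≥0∞) * ((R ω * Θ ω (i - N ω) : ℝ≥0) : ℝ≥0∞)).toNNReal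
  else 0

lemma lexLe_iff_toLex {d : ℕ} (a b : Idx d) : lexLe a b ↔ toLex a ≤ toLex b := by
  rw [le_iff_eq_or_lt]
  rfl

lemma existsUnique_firstMax {d : ℕ} (g : Idx d → ℝ≥0∞) (hs : ∑' i, g i ≠ ∞) (i0 : Idx d)
    (h0 : g i0 ≠ 0) : ∃ j, IsFirstMaxAt g j ∧ g j ≠ 0 ∧ ∀ k, IsFirstMaxAt g k → k = j := by
  have hfin : {i | g i0 ≤ g i}.Finite := ENNReal.finite_const_le_of_tsum_ne_top hs h0
  obtain ⟨m, hm, hmax⟩ := Set.exists_max_image _ g hfin ⟨i0, le_refl (g i0)⟩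
  have hm' : ∀ i, g i ≤ g m := by
    intro i
    by_cases h : g i0 ≤ g i
    · exact hmax i h
    · exact (le_of_not_ge h).trans hm
  have hfin2 : {i | ∀ k, g k ≤ g i}.Finite := hfin.subset (fun i hi => hi i0)
  obtain ⟨j, hj, hmin⟩ := Set.exists_min_image _ (fun i : Idx d => toLex i) hfin2 ⟨m, hm'⟩
  refine ⟨j, ⟨hj, fun i hi => (lexLe_iff_toLex _ _).2 (hmin i hi)⟩, ?_, ?_⟩
  · intro h
    have := hj i0
    rw [h] at this
    exact h0 (le_antisymm this bot_le)
  · intro k hk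
    have h1 := (lexLe_iff_toLex _ _).1 (hk.2 j hj)
    have h2 := hmin k hk.1
    exact toLex.injective (le_antisymm h1 h2)

lemma isFirstMaxAt_mul {d : ℕ} (c : ℝ≥0∞) (hc : c ≠ 0) (hc' : c ≠ ∞) (g : Idx d → ℝ≥0∞)
    (j : Idx d) : IsFirstMaxAt (fun i => c * g i) j ↔ IsFirstMaxAt g j := by
  unfold IsFirstMaxAt
  simp only [ENNReal.mul_le_mul_iff_right hc hc']

lemma measurableSet_firstMax {d : ℕ} {Ω : Type*} [MeasurableSpace Ω] (g : Ω → Idx d → ℝ≥0∞)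
    (hg : Measurable g) (N : Ω → Idx d) (hN : Measurable N) :
    MeasurableSet {ω | IsFirstMaxAt (g ω) (N ω)} := by
  have hg' : ∀ i, Measurable (fun ω => g ω i) := fun i => measurable_pi_iff.1 hg i
  have hev : Measurable (fun ω => g ω (N ω)) := by
    have : Measurable (fun q : Idx d × (Idx d → ℝ≥0∞) => q.2 q.1) :=
      measurable_from_prod_countable_right (fun i => measurable_pi_apply i)
    exact this.comp (hN.prodMk hg)
  unfold IsFirstMaxAt
  refine MeasurableSet.inter (s₁ := {ω | ∀ i, g ω i ≤ g ω (N ω)})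
    (s₂ := {ω | ∀ i, (∀ k, g ω k ≤ g ω i) → lexLe (N ω) i}) ?_ ?_
  · rw [Set.setOf_forall]
    exact MeasurableSet.iInter fun i => measurableSet_le (hg' i) hev
  · rw [Set.setOf_forall]
    refine MeasurableSet.iInter fun i => ?_
    have h1 : MeasurableSet {ω | ∀ k, g ω k ≤ g ω i} := by
      rw [Set.setOf_forall]
      exact MeasurableSet.iInter fun k => measurableSet_le (hg' k) (hg' i)
    have h2 : MeasurableSet {ω | lexLe (N ω) i} :=
      hN (t := {j | lexLe j i}) (Set.to_countable _).measurableSet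
    exact h1.imp h2

lemma measurable_shift {d : ℕ} (h : Idx d) : Measurable (shift h : Fld d → Fld d) :=
  measurable_pi_iff.2 fun t => measurable_pi_apply (t - h)

lemma shift_shift {d : ℕ} (a b : Idx d) (f : Fld d) : shift a (shift b f) = shift (a + b) f := by
  funext t
  simp only [shift]
  congr 1
  abel

lemma measurable_eval_sub {d : ℕ} {Ω : Type*} [MeasurableSpace Ω] (Θ : Ω → Fld d)
    (hΘ : Measurable Θ) (N : Ω → Idx d) (hN : Measurable N) (t : Idx d) :
    Measurable (fun ω => Θ ω (t - N ω)) := by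
  have : Measurable (fun q : Idx d × Fld d => q.2 (t - q.1)) :=
    measurable_from_prod_countable_right (fun i => measurable_pi_apply (t - i))
  exact this.comp (hN.prodMk hΘ)

lemma measurable_ZN {d : ℕ} {Ω : Type*} [MeasurableSpace Ω] (p : Idx d → ℝ≥0) (Θ : Ω → Fld d)
    (hΘ : Measurable Θ) (N : Ω → Idx d) (hN : Measurable N) (R : Ω → ℝ≥0) (hR : Measurable R) :
    Measurable (ZN p N R Θ) := by
  have hm : ∀ t, Measurable (fun ω => ((R ω * Θ ω (t - N ω) : ℝ≥0) : ℝ≥0∞)) := fun t =>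
    (hR.mul (measurable_eval_sub Θ hΘ N hN t)).coe_nnreal_ennreal
  refine measurable_pi_iff.2 fun t => ?_
  unfold ZN
  refine Measurable.ite ?_ ?_ measurable_const
  · exact measurableSet_firstMax
      (fun ω i => (p i : ℝ≥0∞) * ((R ω * Θ ω (i - N ω) : ℝ≥0) : ℝ≥0∞))
      (measurable_pi_iff.2 fun i => (hm i).const_mul _) N hN
  · exact ((hm t).div (Measurable.iSup fun i => (hm i).const_mul _)).ennreal_toNNReal

/-- the indicator of the first-maximizer event at `j` for the field shifted by `s` -/
noncomputable def fmInd {d : ℕ} (p : Idx d → ℝ≥0) (s j : Idx d) (f : Fld d) : ℝ≥0∞ :=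
  if IsFirstMaxAt (fun i => (p i : ℝ≥0∞) * (f (i - s) : ℝ≥0∞)) j then 1 else 0

lemma measurable_fmInd {d : ℕ} (p : Idx d → ℝ≥0) (s j : Idx d) : Measurable (fmInd p s j) := by
  unfold fmInd
  refine Measurable.ite ?_ measurable_const measurable_const
  exact measurableSet_firstMax (fun (f : Fld d) i => (p i : ℝ≥0∞) * (f (i - s) : ℝ≥0∞))
    (measurable_pi_iff.2 fun i => (measurable_pi_apply (i - s)).coe_nnreal_ennreal.const_mul _)
    (fun _ => j) measurable_const

lemma firstMax_scale {d : ℕ} (p : Idx d → ℝ≥0) (s j : Idx d) (c : ℝ≥0) (hc : 0 < c) (f : Fld d) :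
    IsFirstMaxAt (fun i => (p i : ℝ≥0∞) * ((c * f (i - s) : ℝ≥0) : ℝ≥0∞)) j ↔
    IsFirstMaxAt (fun i => (p i : ℝ≥0∞) * (f (i - s) : ℝ≥0∞)) j := by
  rw [← isFirstMaxAt_mul (c : ℝ≥0∞) (by exact_mod_cast hc.ne') ENNReal.coe_ne_top
    (fun i => (p i : ℝ≥0∞) * (f (i - s) : ℝ≥0∞))]
  simp only [ENNReal.coe_mul, mul_left_comm]

lemma homog_fmInd {d : ℕ} (p : Idx d → ℝ≥0) (s j : Idx d) : Homog0 (fmInd p s j) := by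
  intro c hc f
  unfold fmInd
  simp only [firstMax_scale p s j c hc f]

/-- the value of the field on `N = j` -/
lemma ZN_eq {d : ℕ} {Ω : Type*} (p : Idx d → ℝ≥0) (hp : ∀ j, 0 < p j) (Θ : Ω → Fld d)
    (N : Ω → Idx d) (R : Ω → ℝ≥0) (ω : Ω) (hR : 0 < R ω) (h1 : Θ ω 0 = 1)
    (hf : IsFirstMaxAt (fun i => (p i : ℝ≥0∞) * (Θ ω (i - N ω) : ℝ≥0∞)) (N ω)) :
    ZN p N R Θ ω = fun t => (p (N ω))⁻¹ * shift (N ω) (Θ ω) t := by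
  have hf' := (firstMax_scale p (N ω) (N ω) (R ω) hR (Θ ω)).2 hf
  have hsup : (⨆ i, (p i : ℝ≥0∞) * ((R ω * Θ ω (i - N ω) : ℝ≥0) : ℝ≥0∞)) =
      ((p (N ω) * R ω : ℝ≥0) : ℝ≥0∞) := by
    apply le_antisymm
    · refine iSup_le fun i => (hf'.1 i).trans ?_
      simp [h1]
    · refine le_trans ?_ (le_iSup _ (N ω))
      simp [h1]
  funext t
  unfold ZN
  rw [if_pos hf', hsup, ← ENNReal.coe_div (by have := hp (N ω); positivity), ENNReal.toNNReal_coe]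
  have := (hp (N ω)).ne'
  have := hR.ne'
  simp only [shift]
  field_simp

lemma ZN_zero {d : ℕ} {Ω : Type*} (p : Idx d → ℝ≥0) (Θ : Ω → Fld d)
    (N : Ω → Idx d) (R : Ω → ℝ≥0) (ω : Ω) (hR : 0 < R ω)
    (hf : ¬ IsFirstMaxAt (fun i => (p i : ℝ≥0∞) * (Θ ω (i - N ω) : ℝ≥0∞)) (N ω)) :
    ZN p N R Θ ω = fun _ => 0 := by
  funext t
  unfold ZN
  rw [if_neg]
  rwa [firstMax_scale p (N ω) (N ω) (R ω) hR (Θ ω)]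

lemma ZN_integrand {d : ℕ} {Ω : Type*} (p : Idx d → ℝ≥0) (hp : ∀ j, 0 < p j) (Θ : Ω → Fld d)
    (N : Ω → Idx d) (R : Ω → ℝ≥0) (ω : Ω) (hR : 0 < R ω) (h1 : Θ ω 0 = 1)
    (a h : Idx d) (F : Fld d → ℝ≥0∞) (hF : Homog0 F) :
    (ZN p N R Θ ω h : ℝ≥0∞) * F (shift a (ZN p N R Θ ω)) =
     (p (N ω) : ℝ≥0∞)⁻¹ * ((Θ ω (h - N ω) : ℝ≥0∞) *
      (F (shift (a + N ω) (Θ ω)) * fmInd p (N ω) (N ω) (Θ ω))) := by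
  unfold fmInd
  split_ifs with hf
  · rw [ZN_eq p hp Θ N R ω hR h1 hf]
    have e : shift a (fun t => (p (N ω))⁻¹ * shift (N ω) (Θ ω) t) =
      fun t => (p (N ω))⁻¹ * shift (a + N ω) (Θ ω) t := by
      rw [← shift_shift]; rfl
    rw [e, hF _ (inv_pos.2 (hp _)), ENNReal.coe_mul, ENNReal.coe_inv (hp _).ne']
    simp only [shift, mul_one, mul_assoc]
  · rw [ZN_zero p Θ N R ω hR hf]
    simp

lemma ae_summable {d : ℕ} {Ω : Type*} [MeasurableSpace Ω] (P : Measure Ω)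
    [IsProbabilityMeasure P] (Θ : Ω → Fld d) (hΘ : TiltShiftId P Θ)
    (p : Idx d → ℝ≥0) (hp1 : ∑' j, (p j : ℝ≥0∞) = 1) :
    ∀ᵐ ω ∂P, ∀ s, ∑' i, (p i : ℝ≥0∞) * (Θ ω (i - s) : ℝ≥0∞) ≠ ∞ := by
  rw [ae_all_iff]
  intro s
  have hm : ∀ i, Measurable (fun ω => (p i : ℝ≥0∞) * (Θ ω (i - s) : ℝ≥0∞)) := fun i =>
    ((measurable_pi_apply (i - s)).comp hΘ.1).coe_nnreal_ennreal.const_mul _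
  have hle : ∀ h, ∫⁻ ω, (Θ ω h : ℝ≥0∞) ∂P ≤ 1 := by
    intro h
    have := hΘ.2.2 h (fun _ => 1) measurable_const (fun _ _ _ => rfl)
    simp only [mul_one] at this
    rw [this, setLIntegral_one]
    exact prob_le_one
  have : ∫⁻ ω, ∑' i, (p i : ℝ≥0∞) * (Θ ω (i - s) : ℝ≥0∞) ∂P ≠ ∞ := by
    rw [lintegral_tsum fun i => (hm i).aemeasurable]
    refine ne_top_of_le_ne_top ENNReal.one_ne_top ?_
    rw [← hp1]
    refine ENNReal.tsum_le_tsum fun i => ?_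
    rw [lintegral_const_mul' _ _ ENNReal.coe_ne_top]
    exact mul_le_of_le_one_right' (hle _)
  filter_upwards [ae_lt_top (Measurable.ennreal_tsum hm) this] with ω hω
  exact hω.ne

lemma ae_pareto_pos {Ω : Type*} [MeasurableSpace Ω] (P : Measure Ω)
    [IsProbabilityMeasure P] (R : Ω → ℝ≥0) (hR : IsUnitPareto P R) : ∀ᵐ ω ∂P, 0 < R ω := by
  have h1 := hR.2 1 le_rfl
  simp only [inv_one, ENNReal.ofReal_one] at h1
  have hms : MeasurableSet {ω | (1 : ℝ) < (R ω : ℝ)} :=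
    measurableSet_lt measurable_const hR.1.coe_nnreal_real
  have h2 := (prob_compl_eq_zero_iff hms).2 h1
  have : ∀ᵐ ω ∂P, (1 : ℝ) < (R ω : ℝ) := h2
  filter_upwards [this] with ω hω
  have : (0 : ℝ) < (R ω : ℝ) := by linarith
  exact_mod_cast this

lemma main_identity {d : ℕ} {Ω : Type*} [MeasurableSpace Ω] (P : Measure Ω)
    [IsProbabilityMeasure P] (Θ : Ω → Fld d) (hΘ : TiltShiftId P Θ)
    (R : Ω → ℝ≥0) (hR : IsUnitPareto P R)
    (p : Idx d → ℝ≥0) (hp : ∀ j, 0 < p j) (hp1 : ∑' j, (p j : ℝ≥0∞) = 1)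
    (N : Ω → Idx d) (hN : Measurable N) (hNlaw : ∀ j, P {ω | N ω = j} = (p j : ℝ≥0∞))
    (hNind : ProbabilityTheory.IndepFun N (fun ω => (R ω, Θ ω)) P)
    (a h : Idx d) (F : Fld d → ℝ≥0∞) (hFm : Measurable F) (hF : Homog0 F) :
    ∫⁻ ω, (ZN p N R Θ ω h : ℝ≥0∞) * F (shift a (ZN p N R Θ ω)) ∂P =
        ∫⁻ ω, F (shift (a + h) (Θ ω)) ∂P := by
  have hNT : ProbabilityTheory.IndepFun N Θ P :=
    hNind.comp (φ := id) (ψ := Prod.snd) measurable_id measurable_snd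
  let K : Idx d → Fld d → ℝ≥0∞ := fun j f => F (shift (a + j) f) * fmInd p j j f
  have hKm : ∀ j, Measurable (K j) := fun j =>
    (hFm.comp (measurable_shift _)).mul (measurable_fmInd p j j)
  have hKh : ∀ j, Homog0 (K j) := by
    intro j c hc f
    simp only [K]
    rw [homog_fmInd p j j c hc f]
    congr 1
    exact hF c hc (shift (a + j) f)
  let G : Idx d → Fld d → ℝ≥0∞ := fun j f => (p j : ℝ≥0∞)⁻¹ * ((f (h - j) : ℝ≥0∞) * K j f)
  have hGm : ∀ j, Measurable (G j) := fun j =>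
    ((measurable_pi_apply (h - j)).coe_nnreal_ennreal.mul (hKm j)).const_mul _
  let I : Idx d → Idx d → ℝ≥0∞ := fun j => Set.indicator {j} (fun _ => 1)
  have hIm : ∀ j, Measurable (I j) := fun j => measurable_const.indicator (measurableSet_singleton j)
  have hstep1 : ∫⁻ ω, (ZN p N R Θ ω h : ℝ≥0∞) * F (shift a (ZN p N R Θ ω)) ∂P =
      ∫⁻ ω, ∑' j, I j (N ω) * G j (Θ ω) ∂P := by
    refine lintegral_congr_ae ?_
    filter_upwards [ae_pareto_pos P R hR, hΘ.2.1] with ω hr h1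
    rw [ZN_integrand p hp Θ N R ω hr h1 a h F hF, tsum_eq_single (N ω)]
    · simp [I, G, K]
    · intro j hj
      simp [I, hj.symm]
  have hstep2 : ∀ j, ∫⁻ ω, I j (N ω) * G j (Θ ω) ∂P =
      ∫⁻ ω in {ω | Θ ω (-(h - j)) ≠ 0}, K j (shift (h - j) (Θ ω)) ∂P := by
    intro j
    have hind : ProbabilityTheory.IndepFun (fun ω => I j (N ω)) (fun ω => G j (Θ ω)) P :=
      hNT.comp (hIm j) (hGm j)
    have := ProbabilityTheory.lintegral_mul_eq_lintegral_mul_lintegral_of_indepFun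
      ((hIm j).comp hN) ((hGm j).comp hΘ.1) hind
    have e1 : ∫⁻ ω, I j (N ω) ∂P = p j := by
      rw [← hNlaw j]
      exact lintegral_indicator_one (hN (measurableSet_singleton j))
    calc ∫⁻ ω, I j (N ω) * G j (Θ ω) ∂P
        = (∫⁻ ω, I j (N ω) ∂P) * ∫⁻ ω, G j (Θ ω) ∂P := this
      _ = ∫⁻ ω, (Θ ω (h - j) : ℝ≥0∞) * K j (Θ ω) ∂P := by
        have hpj : (p j : ℝ≥0∞) ≠ 0 := by exact_mod_cast (hp j).ne'
        rw [e1]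
        simp only [G]
        rw [lintegral_const_mul' _ _ (ENNReal.inv_ne_top.2 hpj), ← mul_assoc,
          ENNReal.mul_inv_cancel hpj ENNReal.coe_ne_top, one_mul]
      _ = _ := hΘ.2.2 (h - j) (K j) (hKm j) (hKh j)
  have hsetm : ∀ j, MeasurableSet {ω | Θ ω (-(h - j)) ≠ 0} := fun j =>
    ((measurable_pi_apply _).comp hΘ.1) (measurableSet_singleton (0 : ℝ≥0)).compl
  have hKe : ∀ j f, K j (shift (h - j) f) = F (shift (a + h) f) * fmInd p h j f := by
    intro j f
    simp only [K, shift_shift]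
    have hadd : a + j + (h - j) = a + h := by abel
    rw [hadd]
    congr 1
    · unfold fmInd
      have : ∀ i, shift (h - j) f (i - j) = f (i - h) := by
        intro i
        simp only [shift]
        congr 1; abel
      simp only [this]
  rw [hstep1, lintegral_tsum (f := fun j ω => I j (N ω) * G j (Θ ω))
    fun j => (((hIm j).comp hN).mul ((hGm j).comp hΘ.1)).aemeasurable]
  simp only [hstep2]
  simp_rw [← lintegral_indicator (hsetm _)]
  rw [← lintegral_tsum (f := fun j => Set.indicator {ω | Θ ω (-(h - j)) ≠ 0}
      (fun ω => K j (shift (h - j) (Θ ω)))) fun j =>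
    (((hKm j).comp ((measurable_shift _).comp hΘ.1)).indicator (hsetm j)).aemeasurable]
  refine lintegral_congr_ae ?_
  filter_upwards [hΘ.2.1, ae_summable P Θ hΘ p hp1] with ω h1 hs
  have hpos : (p h : ℝ≥0∞) * (Θ ω (h - h) : ℝ≥0∞) ≠ 0 := by
    simp [h1, (hp h).ne']
  obtain ⟨j, hj, hj0, huniq⟩ := existsUnique_firstMax
    (fun i => (p i : ℝ≥0∞) * (Θ ω (i - h) : ℝ≥0∞)) (hs h) h hpos
  rw [tsum_eq_single j]
  · have hmem : ω ∈ {ω | Θ ω (-(h - j)) ≠ 0} := by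
      simp only [Set.mem_setOf_eq, neg_sub]
      intro h0
      simp [h0] at hj0
    rw [Set.indicator_of_mem hmem, hKe]
    unfold fmInd
    rw [if_pos hj, mul_one]
  · intro k hk
    refine Set.indicator_apply_eq_zero.2 fun _ => ?_
    rw [hKe]
    unfold fmInd
    rw [if_neg (fun hh => hk (huniq k hh)), mul_zero]

/-- Given `Θ*` satisfying the tilt-shift identity, a unit Pareto `R`
independent of `Θ*`, weights `p` with `Σ p_j = 1` and an independent label `N` with
`P(N = j) = p_j`, the field `Z_N` is a.s. well defined, satisfies
`E[Z_N(h) F(B^a Z_N)] = E[F(B^{a+h} Θ*)] = E[Z_N(a) F(B^h Z_N)]` for all measurable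
0-homogeneous `F`, is Brown–Resnick stationary with unit means, and its spectral tail
field has the same law as `Θ*`. -/
theorem stmt3 {d : ℕ} (hd : 0 < d) {Ω : Type*} [MeasurableSpace Ω] (P : Measure Ω)
    [IsProbabilityMeasure P] (Θ : Ω → Fld d) (hΘ : TiltShiftId P Θ)
    (R : Ω → ℝ≥0) (hR : IsUnitPareto P R)
    (hRΘ : ProbabilityTheory.IndepFun R Θ P)
    (p : Idx d → ℝ≥0) (hp : ∀ j, 0 < p j ∧ p j < 1) (hp1 : ∑' j, (p j : ℝ≥0∞) = 1)
    (N : Ω → Idx d) (hN : Measurable N) (hNlaw : ∀ j, P {ω | N ω = j} = (p j : ℝ≥0∞))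
    (hNind : ProbabilityTheory.IndepFun N (fun ω => (R ω, Θ ω)) P) :
    (∀ᵐ ω ∂P,
      0 < (⨆ i, (p i : ℝ≥0∞) * ((R ω * Θ ω (i - N ω) : ℝ≥0) : ℝ≥0∞)) ∧
      (⨆ i, (p i : ℝ≥0∞) * ((R ω * Θ ω (i - N ω) : ℝ≥0) : ℝ≥0∞)) < ∞) ∧
    (∀ (a h : Idx d) (F : Fld d → ℝ≥0∞), Measurable F → Homog0 F →
      (∫⁻ ω, (ZN p N R Θ ω h : ℝ≥0∞) * F (shift a (ZN p N R Θ ω)) ∂P =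
        ∫⁻ ω, F (shift (a + h) (Θ ω)) ∂P) ∧
      (∫⁻ ω, (ZN p N R Θ ω a : ℝ≥0∞) * F (shift h (ZN p N R Θ ω)) ∂P =
        ∫⁻ ω, F (shift (a + h) (Θ ω)) ∂P)) ∧
    IsBRS P (ZN p N R Θ) ∧
    (∀ A : Set (Fld d), MeasurableSet A →
      ∫⁻ ω, (ZN p N R Θ ω 0 : ℝ≥0∞) *
        A.indicator (fun _ => (1 : ℝ≥0∞)) (fun t => ZN p N R Θ ω t / ZN p N R Θ ω 0) ∂P =
      P (Θ ⁻¹' A)) := by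
  have hp0 : ∀ j, 0 < p j := fun j => (hp j).1
  have main := main_identity P Θ hΘ R hR p hp0 hp1 N hN hNlaw hNind
  refine ⟨?_, ?_, ⟨measurable_ZN p Θ hΘ.1 N hN R hR.1, ?_, ?_⟩, ?_⟩
  · filter_upwards [ae_pareto_pos P R hR, hΘ.2.1, ae_summable P Θ hΘ p hp1] with ω hr h1 hs
    constructor
    · refine lt_of_lt_of_le ?_ (le_iSup _ (N ω))
      simp [h1, pos_iff_ne_zero, (hp0 (N ω)).ne', hr.ne']
    · have hlt : (R ω : ℝ≥0∞) * ∑' i, (p i : ℝ≥0∞) * (Θ ω (i - N ω) : ℝ≥0∞) < ∞ :=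
        ENNReal.mul_lt_top ENNReal.coe_lt_top (hs (N ω)).lt_top
      refine lt_of_le_of_lt (iSup_le fun i => ?_) hlt
      rw [ENNReal.coe_mul, mul_left_comm]
      gcongr
      exact ENNReal.le_tsum i
  · intro a h F hFm hF
    refine ⟨main a h F hFm hF, ?_⟩
    rw [main h a F hFm hF, add_comm]
  · intro t
    have := main 0 t (fun _ => 1) measurable_const (fun _ _ _ => rfl)
    simpa using this
  · intro h F hFm hF
    have e1 := main 0 h F hFm hF
    have e2 := main h 0 F hFm hF
    have e0 : ∀ f : Fld d, shift 0 f = f := fun f => by funext t; simp [shift]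
    simp only [zero_add, add_zero, e0] at e1 e2
    rw [e1, e2]
  · intro A hA
    have e0 : ∀ f : Fld d, shift 0 f = f := fun f => by funext t; simp [shift]
    have hm : Measurable (fun f : Fld d => (fun t => f t / f 0 : Fld d)) :=
      measurable_pi_iff.2 fun t => (measurable_pi_apply t).div (measurable_pi_apply 0)
    have e := main 0 0 (fun f => A.indicator (fun _ => (1 : ℝ≥0∞)) (fun t => f t / f 0))
      ((measurable_const.indicator hA).comp hm) (by
        intro c hc f
        simp only [mul_div_mul_left _ _ hc.ne'])
    simp only [add_zero, e0] at e
    rw [e, ← lintegral_indicator_one (hΘ.1 hA)]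
    refine lintegral_congr_ae ?_
    filter_upwards [hΘ.2.1] with ω h1
    simp only [h1, div_one]
    rfl
end

section
/- Let Θ be a random field with values in E satisfying the tilt-shift identity, let R be a unit Pareto random variable (P(R > x) = 1/x, x ≥ 1) independent of Θ, and set Y(t) = R·Θ(t). Then for any two anchoring maps I, I' and any shift-invariant measurable map F : E → [0,∞]: P(I(Y) = 0, I'(Y) ∈ ℤ^d, F(Y) < ∞) = P(I'(Y) = 0, I(Y) ∈ ℤ^d, F(Y) < ∞). Moreover, P(I(Y) = 0, F(Y) < ∞) = 0 if and only if P(I(Y) ∈ ℤ^d, F(Y) < ∞) = 0. -/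
open MeasureTheory ENNReal Filter
open scoped NNReal ENNReal

/-- `F` is shift-invariant: `F (B^h f) = F f`. -/
def ShiftInv {d : ℕ} (F : Fld d → ℝ≥0∞) : Prop :=
  ∀ (h : Idx d) (f : Fld d), F (shift h f) = F f

/-- An anchoring map `I : E → ℤ^d ∪ {∞}` (`∞` encoded by `none`): measurable, with
`I(f) = i → f(i) ≥ min(f(0), 1)` and `I(B^j f) = I(f) + j` whenever `I(f) ∈ ℤ^d`. -/
structure Anchoring {d : ℕ} (I : Fld d → Option (Idx d)) : Prop where
  meas : ∀ i : Idx d, MeasurableSet {f : Fld d | I f = some i}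
  lower : ∀ (f : Fld d) (i : Idx d), I f = some i → min (f 0) 1 ≤ f i
  shift_rel : ∀ (f : Fld d) (i j : Idx d), I f = some i → I (shift j f) = some (i + j)


lemma pareto_Ici {Ω : Type*} [MeasurableSpace Ω] (P : Measure Ω) [IsProbabilityMeasure P]
    (R : Ω → ℝ≥0) (hR : IsUnitPareto P R) (x : ℝ≥0) :
    P.map R (Set.Ici x) = (((max x 1)⁻¹ : ℝ≥0) : ℝ≥0∞) := by
  have hgt : ∀ y : ℝ≥0, 1 ≤ y → P (R ⁻¹' Set.Ioi y) = ((y⁻¹ : ℝ≥0) : ℝ≥0∞) := by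
    intro y hy
    have h := hR.2 (y : ℝ) (by exact_mod_cast hy)
    have e : R ⁻¹' Set.Ioi y = {ω | (y : ℝ) < (R ω : ℝ)} := by
      ext ω; simp
    rw [e, h, ← NNReal.coe_inv, ENNReal.ofReal_coe_nnreal]
  rw [Measure.map_apply hR.1 measurableSet_Ici]
  rcases le_or_gt x 1 with hx | hx
  · rw [max_eq_right hx]
    apply le_antisymm
    · simpa using prob_le_one
    · rw [← hgt 1 le_rfl]
      exact measure_mono (fun ω hω => hx.trans (le_of_lt hω))
  · rw [max_eq_left hx.le]
    apply le_antisymm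
    · have hx0 : (0 : ℝ≥0) < x := lt_trans one_pos hx
      have ht : Tendsto (fun y : ℝ≥0 => ((y⁻¹ : ℝ≥0) : ℝ≥0∞)) (nhdsWithin x (Set.Iio x))
          (nhds ((x⁻¹ : ℝ≥0) : ℝ≥0∞)) := by
        apply ENNReal.tendsto_coe.2
        exact (tendsto_inv₀ hx0.ne').mono_left nhdsWithin_le_nhds
      have : (nhdsWithin x (Set.Iio x)).NeBot := nhdsLT_neBot_of_exists_lt ⟨1, hx⟩
      refine ge_of_tendsto ht ?_
      filter_upwards [Ioo_mem_nhdsLT hx] with y hy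
      rw [← hgt y hy.1.le]
      exact measure_mono (fun ω hω => lt_of_lt_of_le hy.2 hω)
    · rw [← hgt x hx.le]
      exact measure_mono (fun ω hω => Set.mem_preimage.2 (Set.mem_Ici.2 (le_of_lt hω)))

lemma pareto_scale (μ : Measure ℝ≥0) [IsProbabilityMeasure μ]
    (hμ : ∀ x : ℝ≥0, μ (Set.Ici x) = (((max x 1)⁻¹ : ℝ≥0) : ℝ≥0∞))
    (a : ℝ≥0) (ha : a ≠ 0) (T : Set ℝ≥0) (hT : MeasurableSet T) :
    (a : ℝ≥0∞) * μ {r | r / a ∈ T ∧ a ≤ r} = μ {r | r ∈ T ∧ 1 ≤ r * a} := by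
  have ha' : 0 < a := pos_iff_ne_zero.2 ha
  have hm : Measurable (fun r : ℝ≥0 => r / a) := by fun_prop
  have key : a • ((μ.restrict (Set.Ici a)).map (fun r => r / a)) =
      μ.restrict (Set.Ici a⁻¹) := by
    apply Measure.ext_of_Ici
    intro x
    rw [Measure.smul_apply, Measure.map_apply hm measurableSet_Ici,
      Measure.restrict_apply (hm measurableSet_Ici), Measure.restrict_apply measurableSet_Ici]
    have e1 : (fun r : ℝ≥0 => r / a) ⁻¹' Set.Ici x ∩ Set.Ici a = Set.Ici (max (x * a) a) := by
      ext r; simp [le_div_iff₀ ha']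
    have e2 : Set.Ici x ∩ Set.Ici a⁻¹ = Set.Ici (max x a⁻¹) := by
      ext r; simp
    rw [e1, e2, hμ, hμ, ENNReal.smul_def, smul_eq_mul, ← ENNReal.coe_mul]
    congr 1
    have : max (max (x * a) a) 1 = max (max x a⁻¹) 1 * a := by
      rw [max_mul_of_nonneg _ _ ha'.le, max_mul_of_nonneg _ _ ha'.le, inv_mul_cancel₀ ha, one_mul,
        max_right_comm]
    rw [this, mul_inv, mul_comm, mul_assoc, inv_mul_cancel₀ ha, mul_one]
  have h := congrArg (fun m => m T) key
  simp only [Measure.smul_apply] at h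
  rw [Measure.map_apply hm hT, Measure.restrict_apply (hm hT), Measure.restrict_apply hT,
    ENNReal.smul_def, smul_eq_mul] at h
  have e : {r : ℝ≥0 | r ∈ T ∧ 1 ≤ r * a} = T ∩ Set.Ici a⁻¹ := by
    ext r
    simp [inv_le_iff_one_le_mul₀ ha']
  rw [e]
  exact h

lemma shift_key {d : ℕ} {Ω : Type*} [MeasurableSpace Ω] (P : Measure Ω)
    [IsProbabilityMeasure P] (Θ : Ω → Fld d) (hΘ : TiltShiftId P Θ)
    (R : Ω → ℝ≥0) (hR : IsUnitPareto P R)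
    (hRΘ : ProbabilityTheory.IndepFun R Θ P) (S : Set (Fld d)) (hS : MeasurableSet S)
    (h : Idx d) :
    P {ω | (fun t => R ω * Θ ω t) ∈ S ∧ 1 ≤ R ω * Θ ω h} =
    P {ω | shift h (fun t => R ω * Θ ω t) ∈ S ∧ 1 ≤ R ω * Θ ω (-h)} := by
  obtain ⟨hΘm, hΘ0, hTS⟩ := hΘ
  set μ := P.map R with hμdef
  have : IsProbabilityMeasure μ := Measure.isProbabilityMeasure_map hR.1.aemeasurable
  have hμ := pareto_Ici P R hR
  have hprod : ∀ T : Set (ℝ≥0 × Fld d), MeasurableSet T →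
      P {ω | (R ω, Θ ω) ∈ T} = ∫⁻ ω, μ {r | (r, Θ ω) ∈ T} ∂P := by
    intro T hT
    have h1 := (ProbabilityTheory.indepFun_iff_map_prod_eq_prod_map_map
      hR.1.aemeasurable hΘm.aemeasurable).1 hRΘ
    have h2 := congrArg (fun m => m T) h1
    rw [Measure.map_apply (hR.1.prodMk hΘm) hT, Measure.prod_apply_symm hT,
      lintegral_map (measurable_measure_prodMk_right hT) hΘm] at h2
    exact h2
  have hsh : Measurable (fun f : Fld d => shift h f) := by
    unfold shift; fun_prop
  have hT1 : MeasurableSet {p : ℝ≥0 × Fld d | (fun t => p.1 * p.2 t) ∈ S ∧ 1 ≤ p.1 * p.2 h} := by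
    apply MeasurableSet.inter
    · exact (show Measurable (fun p : ℝ≥0 × Fld d => (fun t => p.1 * p.2 t)) by fun_prop) hS
    · exact measurableSet_le measurable_const (by fun_prop)
  have hT2 : MeasurableSet {p : ℝ≥0 × Fld d |
      shift h (fun t => p.1 * p.2 t) ∈ S ∧ 1 ≤ p.1 * p.2 (-h)} := by
    apply MeasurableSet.inter
    · exact (hsh.comp
        (show Measurable (fun p : ℝ≥0 × Fld d => (fun t => p.1 * p.2 t)) by fun_prop)) hS
    · exact measurableSet_le measurable_const (by fun_prop)
  have hT3 : MeasurableSet {p : ℝ≥0 × Fld d |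
      (fun t => p.1 * (p.2 t / p.2 0)) ∈ S ∧ p.2 0 ≤ p.1 * p.2 h} := by
    apply MeasurableSet.inter
    · exact (show Measurable (fun p : ℝ≥0 × Fld d => (fun t => p.1 * (p.2 t / p.2 0)))
        by fun_prop) hS
    · exact measurableSet_le (by fun_prop) (by fun_prop)
  have H1 := hprod _ hT1
  have H2 := hprod _ hT2
  simp only [Set.mem_ofPred_eq] at H1 H2
  rw [H1, H2]
  let H : Fld d → ℝ≥0∞ := fun f => ((f 0 / f h : ℝ≥0) : ℝ≥0∞) *
    μ {r | (fun t => r * (f t / f 0)) ∈ S ∧ f 0 ≤ r * f h}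
  have hHm : Measurable H := by
    apply Measurable.mul
    · exact (show Measurable (fun f : Fld d => f 0 / f h) by fun_prop).coe_nnreal_ennreal
    · exact measurable_measure_prodMk_right hT3
  have hHh : Homog0 H := by
    intro c hc f
    have hc' : c ≠ 0 := hc.ne'
    simp only [H]
    simp only [mul_div_mul_left _ _ hc', mul_left_comm _ c, mul_le_mul_iff_right₀ hc]
  have hmain := hTS h H hHm hHh
  have hL : ∫⁻ ω, (Θ ω h : ℝ≥0∞) * H (Θ ω) ∂P =
      ∫⁻ ω, μ {r | (fun t => r * Θ ω t) ∈ S ∧ 1 ≤ r * Θ ω h} ∂P := by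
    apply lintegral_congr_ae
    filter_upwards [hΘ0] with ω h0
    simp only [H, h0, div_one]
    by_cases hz : Θ ω h = 0
    · simp [hz]
    · rw [← mul_assoc, ← ENNReal.coe_mul, mul_one_div_cancel hz, ENNReal.coe_one, one_mul]
  have hmeas : MeasurableSet {ω | Θ ω (-h) ≠ 0} := by
    exact ((measurable_pi_apply (-h)).comp hΘm) (measurableSet_singleton 0).compl
  rw [hL, ← lintegral_indicator hmeas] at hmain
  rw [hmain]
  apply lintegral_congr_ae
  filter_upwards [hΘ0] with ω h0
  by_cases hz : Θ ω (-h) = 0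
  · simp [hz]
  · rw [Set.indicator_of_mem (show ω ∈ {ω | Θ ω (-h) ≠ 0} from hz)]
    simp only [H, shift, sub_self, zero_sub, h0, div_one, mul_one]
    have hT : MeasurableSet {r : ℝ≥0 | (fun t => r * Θ ω (t - h)) ∈ S} :=
      (show Measurable (fun r : ℝ≥0 => (fun t => r * Θ ω (t - h))) by fun_prop) hS
    have := pareto_scale μ hμ (Θ ω (-h)) hz _ hT
    simp only [Set.mem_ofPred_eq] at this
    refine Eq.trans ?_ this
    simp only [mul_div_assoc', div_mul_eq_mul_div]

lemma shift_shift_neg {d : ℕ} (j : Idx d) (f : Fld d) : shift (-j) (shift j f) = f := by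
  ext t; simp [shift]

lemma Anchoring.shift_iff {d : ℕ} {I : Fld d → Option (Idx d)} (hI : Anchoring I)
    (f : Fld d) (i j : Idx d) : I (shift j f) = some i ↔ I f = some (i - j) := by
  constructor
  · intro h
    have := hI.shift_rel _ _ (-j) h
    rwa [shift_shift_neg, ← sub_eq_add_neg] at this
  · intro h
    have := hI.shift_rel _ _ j h
    rwa [sub_add_cancel] at this

/-- Let `Θ` satisfy the tilt-shift identity, `R` be a unit Pareto
independent of `Θ` and `Y = R·Θ`.  For any two anchoring maps `I, I'` and any
shift-invariant measurable `F : E → [0,∞]`,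
`P(I(Y) = 0, I'(Y) ∈ ℤ^d, F(Y) < ∞) = P(I'(Y) = 0, I(Y) ∈ ℤ^d, F(Y) < ∞)`;
moreover `P(I(Y) = 0, F(Y) < ∞) = 0` iff `P(I(Y) ∈ ℤ^d, F(Y) < ∞) = 0`. -/
theorem stmt4 {d : ℕ} (hd : 0 < d) {Ω : Type*} [MeasurableSpace Ω] (P : Measure Ω)
    [IsProbabilityMeasure P] (Θ : Ω → Fld d) (hΘ : TiltShiftId P Θ)
    (R : Ω → ℝ≥0) (hR : IsUnitPareto P R)
    (hRΘ : ProbabilityTheory.IndepFun R Θ P)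
    (I I' : Fld d → Option (Idx d)) (hI : Anchoring I) (hI' : Anchoring I')
    (F : Fld d → ℝ≥0∞) (hFmeas : Measurable F) (hFinv : ShiftInv F) :
    (P {ω | I (fun t => R ω * Θ ω t) = some 0 ∧ (∃ i, I' (fun t => R ω * Θ ω t) = some i) ∧
        F (fun t => R ω * Θ ω t) < ∞} =
      P {ω | I' (fun t => R ω * Θ ω t) = some 0 ∧ (∃ i, I (fun t => R ω * Θ ω t) = some i) ∧
        F (fun t => R ω * Θ ω t) < ∞}) ∧
    (P {ω | I (fun t => R ω * Θ ω t) = some 0 ∧ F (fun t => R ω * Θ ω t) < ∞} = 0 ↔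
      P {ω | (∃ i, I (fun t => R ω * Θ ω t) = some i) ∧
        F (fun t => R ω * Θ ω t) < ∞} = 0) := by
  have hY : Measurable (fun ω => (fun t => R ω * Θ ω t)) := by
    have h1 := hΘ.1
    have h2 := hR.1
    fun_prop
  have hR1 : ∀ᵐ ω ∂P, 1 ≤ R ω := by
    have h := pareto_Ici P R hR 1
    rw [Measure.map_apply hR.1 measurableSet_Ici] at h
    have h' : P (R ⁻¹' Set.Ici 1) = 1 := by simpa using h
    exact (prob_compl_eq_zero_iff (hR.1 measurableSet_Ici)).2 h'
  have hge : ∀ J : Fld d → Option (Idx d), Anchoring J → ∀ᵐ ω ∂P, ∀ i,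
      J (fun t => R ω * Θ ω t) = some i → 1 ≤ R ω * Θ ω i := by
    intro J hJ
    filter_upwards [hR1, hΘ.2.1] with ω h1 h0 i hi
    have := hJ.lower _ _ hi
    simpa [h0, h1] using this
  have hFm : MeasurableSet {f : Fld d | F f < ∞} := measurableSet_lt hFmeas measurable_const
  constructor
  · have split : ∀ J J' : Fld d → Option (Idx d), Anchoring J → Anchoring J' →
        P {ω | J (fun t => R ω * Θ ω t) = some 0 ∧ (∃ i, J' (fun t => R ω * Θ ω t) = some i) ∧
        F (fun t => R ω * Θ ω t) < ∞} = ∑' i : Idx d,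
        P {ω | J (fun t => R ω * Θ ω t) = some 0 ∧ J' (fun t => R ω * Θ ω t) = some i ∧
        F (fun t => R ω * Θ ω t) < ∞} := by
      intro J J' hJ hJ'
      rw [← measure_iUnion]
      · congr 1
        ext ω
        simp
      · intro i j hij
        refine Set.disjoint_left.2 ?_
        intro ω hi hj
        exact hij (Option.some.inj (hi.2.1.symm.trans hj.2.1))
      · intro i
        exact hY (((hJ.meas 0).inter ((hJ'.meas i).inter hFm)))
    rw [split I I' hI hI', split I' I hI' hI, ← (Equiv.neg (Idx d)).tsum_eq]
    apply tsum_congr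
    intro i
    have key := shift_key P Θ hΘ R hR hRΘ
      {f | I' f = some 0 ∧ I f = some i ∧ F f < ∞}
      ((hI'.meas 0).inter ((hI.meas i).inter hFm)) i
    simp only [Set.mem_ofPred_eq, hI.shift_iff, hI'.shift_iff, hFinv i _, zero_sub, sub_self] at key
    rw [Equiv.neg_apply]
    trans P {ω | (I' (fun t => R ω * Θ ω t) = some (-i) ∧ I (fun t => R ω * Θ ω t) = some 0 ∧
        F (fun t => R ω * Θ ω t) < ∞) ∧ 1 ≤ R ω * Θ ω (-i)}
    · apply measure_congr
      filter_upwards [hge I' hI'] with ω hω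
      apply propext
      constructor
      · rintro ⟨a, b, c⟩
        exact ⟨⟨b, a, c⟩, hω _ b⟩
      · rintro ⟨⟨b, a, c⟩, _⟩
        exact ⟨a, b, c⟩
    · rw [← key]
      apply measure_congr
      filter_upwards [hge I hI] with ω hω
      apply propext
      constructor
      · rintro ⟨a, _⟩
        exact a
      · rintro ⟨a, b, c⟩
        exact ⟨⟨a, b, c⟩, hω _ b⟩
  · constructor
    · intro h0
      have e : {ω | (∃ i, I (fun t => R ω * Θ ω t) = some i) ∧ F (fun t => R ω * Θ ω t) < ∞} =
          ⋃ i, {ω | I (fun t => R ω * Θ ω t) = some i ∧ F (fun t => R ω * Θ ω t) < ∞} := by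
        ext ω
        simp
      rw [e, measure_iUnion_null_iff]
      intro i
      have key := shift_key P Θ hΘ R hR hRΘ {f | I f = some i ∧ F f < ∞}
        ((hI.meas i).inter hFm) i
      simp only [Set.mem_ofPred_eq, hI.shift_iff, hFinv i _, sub_self] at key
      have hz : P {ω | (I (fun t => R ω * Θ ω t) = some 0 ∧ F (fun t => R ω * Θ ω t) < ∞) ∧
          1 ≤ R ω * Θ ω (-i)} = 0 := measure_mono_null (fun ω hω => hω.1) h0
      rw [hz] at key
      rw [← key]
      apply measure_congr
      filter_upwards [hge I hI] with ω hω
      apply propext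
      exact ⟨fun a => ⟨a, hω _ a.1⟩, fun a => a.1⟩
    · intro h0
      refine measure_mono_null ?_ h0
      intro ω hω
      exact ⟨⟨0, hω.1⟩, hω.2⟩
end

section
/- Let Z be a Brown–Resnick stationary random field with values in E satisfying E[Z(t)] = 1 for all t ∈ ℤ^d and max_{t∈ℤ^d} Z(t) > 0 almost surely, let Θ be its spectral tail field, let R be a unit Pareto random variable independent of Θ, and set Y = R·Θ and H_Z = lim_{n→∞} n^{−d} E[max_{t∈{0,…,n}^d} Z(t)]. Then H_Z = 0 if and only if P(Σ_{t∈ℤ^d} Θ(t) = ∞) = P(Σ_{t∈ℤ^d} Z(t) = ∞) = 1. If moreover I is an anchoring map satisfying P(I(Y) ∈ ℤ^d, Σ_t Y(t) < ∞) = P(Σ_t Y(t) < ∞), then H_Z = 0 is equivalent to P(I(Y) = 0, Σ_t Y(t) < ∞) = 0. -/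
open MeasureTheory ENNReal Filter
open scoped NNReal ENNReal

/-- The spectral tail field: `Θ` (on a possibly different probability space `Q`) has law
`P(Θ ∈ A) = E[Z(0)·1{Z/Z(0) ∈ A}]` (the integrand vanishing on `{Z(0) = 0}`). -/
def IsSpectralTail {d : ℕ} {Ω Ω' : Type*} [MeasurableSpace Ω] [MeasurableSpace Ω']
    (P : Measure Ω) (Z : Ω → Fld d) (Q : Measure Ω') (Θ : Ω' → Fld d) : Prop :=
  Measurable Θ ∧ ∀ A : Set (Fld d), MeasurableSet A →
    Q (Θ ⁻¹' A) =
      ∫⁻ ω, (Z ω 0 : ℝ≥0∞) *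
        A.indicator (fun _ => (1 : ℝ≥0∞)) (fun t => Z ω t / Z ω 0) ∂P

namespace BR

noncomputable def T {d : ℕ} (f : Fld d) : ℝ≥0∞ := ∑' t : Idx d, (f t : ℝ≥0∞)

lemma meas_T {d : ℕ} : Measurable (T (d := d)) := by
  unfold T
  exact Measurable.tsum fun t => by fun_prop

lemma T_smul {d : ℕ} (c : ℝ≥0) (f : Fld d) : T (fun t => c * f t) = c * T f := by
  simp [T, ENNReal.tsum_mul_left]

lemma T_shift {d : ℕ} (h : Idx d) (f : Fld d) : T (shift h f) = T f := by
  unfold T shift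
  exact (Equiv.subRight h).tsum_eq (fun t => (f t : ℝ≥0∞))

lemma meas_shift {d : ℕ} (h : Idx d) : Measurable (shift (d := d) h) := by
  unfold shift
  fun_prop

noncomputable def finInd {d : ℕ} (f : Fld d) : ℝ≥0∞ :=
  {g : Fld d | T g < ∞}.indicator (fun _ => (1 : ℝ≥0∞)) f

lemma measSet_fin {d : ℕ} : MeasurableSet {g : Fld d | T g < ∞} :=
  measurableSet_lt meas_T measurable_const

lemma meas_finInd {d : ℕ} : Measurable (finInd (d := d)) :=
  measurable_const.indicator measSet_fin

lemma T_smul_lt {d : ℕ} (c : ℝ≥0) (hc : 0 < c) (f : Fld d) :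
    T (fun t => c * f t) < ∞ ↔ T f < ∞ := by
  rw [T_smul]
  constructor
  · intro h
    by_contra h2
    simp only [not_lt, top_le_iff] at h2
    rw [h2, ENNReal.mul_top (by simpa using hc.ne')] at h
    exact lt_irrefl _ h
  · intro h
    exact ENNReal.mul_lt_top ENNReal.coe_lt_top h

lemma homog_finInd {d : ℕ} : Homog0 (finInd (d := d)) := by
  intro c hc f
  have := T_smul_lt c hc f
  by_cases h : T f < ∞ <;> simp [finInd, Set.indicator, this, h]

lemma finInd_shift {d : ℕ} (h : Idx d) (f : Fld d) : finInd (shift h f) = finInd f := by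
  simp [finInd, Set.indicator, T_shift]

lemma finInd_eq_zero {d : ℕ} (f : Fld d) : finInd f = 0 ↔ T f = ∞ := by
  by_cases h : T f = ∞
  · simp [finInd, Set.indicator, h]
  · simp [finInd, Set.indicator, h, lt_top_iff_ne_top]

section
variable {d : ℕ} {Ω Ω' : Type*} [MeasurableSpace Ω] [MeasurableSpace Ω']
    {P : Measure Ω} {Q : Measure Ω'} {Z : Ω → Fld d} {Θ : Ω' → Fld d}

lemma meas_Zt (hZ : IsBRS P Z) (t : Idx d) : Measurable fun ω => (Z ω t : ℝ≥0∞) := by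
  have := (measurable_pi_apply t).comp hZ.meas
  exact measurable_coe_nnreal_ennreal.comp this

lemma meas_ZG (hZ : IsBRS P Z) (t : Idx d) {G : Fld d → ℝ≥0∞} (hG : Measurable G) :
    Measurable fun ω => (Z ω t : ℝ≥0∞) * G (Z ω) :=
  (meas_Zt hZ t).mul (hG.comp hZ.meas)

/-- a.s. infinite sum iff tilted infinite sum -/
lemma key_iff (hZ : IsBRS P Z) (hZpos : ∀ᵐ ω ∂P, ∃ t, 0 < Z ω t) :
    (∀ᵐ ω ∂P, T (Z ω) = ∞) ↔ ∫⁻ ω, (Z ω 0 : ℝ≥0∞) * finInd (Z ω) ∂P = 0 := by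
  constructor
  · intro h
    rw [lintegral_eq_zero_iff (meas_ZG hZ 0 meas_finInd)]
    filter_upwards [h] with ω hω
    simp [(finInd_eq_zero _).2 hω]
  · intro h
    have h1 : ∀ t : Idx d, ∀ᵐ ω ∂P, (Z ω t : ℝ≥0∞) * finInd (Z ω) = 0 := by
      intro t
      have h2 := hZ.tilt_shift t finInd meas_finInd homog_finInd
      simp_rw [finInd_shift] at h2
      rw [h] at h2
      exact (lintegral_eq_zero_iff (meas_ZG hZ t meas_finInd)).1 h2
    filter_upwards [ae_all_iff.2 h1, hZpos] with ω h2 ⟨t, ht⟩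
    have := h2 t
    rw [mul_eq_zero] at this
    rcases this with h3 | h3
    · simp at h3; simp [h3] at ht
    · exact (finInd_eq_zero _).1 h3

lemma tail_lintegral (hZ : IsBRS P Z) (hΘ : IsSpectralTail P Z Q Θ)
    (G : Fld d → ℝ≥0∞) (hG : Measurable G) :
    ∫⁻ ω, G (Θ ω) ∂Q = ∫⁻ ω, (Z ω 0 : ℝ≥0∞) * G (fun t => Z ω t / Z ω 0) ∂P := by
  have hm : Measurable fun ω => (fun t => Z ω t / Z ω 0 : Fld d) := by
    have := hZ.meas
    refine measurable_pi_lambda _ fun t => ?_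
    exact ((measurable_pi_apply t).comp hZ.meas).div ((measurable_pi_apply 0).comp hZ.meas)
  have hlaw : Q.map Θ = (P.withDensity fun ω => (Z ω 0 : ℝ≥0∞)).map
      (fun ω => (fun t => Z ω t / Z ω 0 : Fld d)) := by
    ext A hA
    rw [Measure.map_apply hΘ.1 hA, Measure.map_apply hm hA, hΘ.2 A hA,
      withDensity_apply _ (hm hA), ← lintegral_indicator (hm hA)]
    refine lintegral_congr fun ω => ?_
    by_cases h : (fun t => Z ω t / Z ω 0 : Fld d) ∈ A <;> simp [Set.indicator, h]
  rw [← lintegral_map hG hΘ.1, hlaw, lintegral_map hG hm]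
  exact lintegral_withDensity_eq_lintegral_mul _ (meas_Zt hZ 0) (hG.comp hm)

lemma tail_fin (hZ : IsBRS P Z) (hΘ : IsSpectralTail P Z Q Θ) :
    Q {ω | T (Θ ω) < ∞} = ∫⁻ ω, (Z ω 0 : ℝ≥0∞) * finInd (Z ω) ∂P := by
  have h := tail_lintegral hZ hΘ finInd meas_finInd
  have h1 : ∫⁻ ω, finInd (Θ ω) ∂Q = Q {ω | T (Θ ω) < ∞} := by
    exact lintegral_indicator_one (μ := Q) (hΘ.1 measSet_fin)
  rw [← h1, h]
  refine lintegral_congr fun ω => ?_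
  by_cases h0 : Z ω 0 = 0
  · simp [h0]
  · congr 1
    have := homog_finInd (Z ω 0)⁻¹ (by positivity) (Z ω)
    rw [← this]
    congr 1
    ext t
    rw [div_eq_inv_mul]

lemma tail_iff [IsProbabilityMeasure Q] (hZ : IsBRS P Z)
    (hZpos : ∀ᵐ ω ∂P, ∃ t, 0 < Z ω t) (hΘ : IsSpectralTail P Z Q Θ) :
    (∀ᵐ ω ∂P, T (Z ω) = ∞) ↔ ∀ᵐ ω ∂Q, T (Θ ω) = ∞ := by
  rw [key_iff hZ hZpos, ← tail_fin hZ hΘ, ae_iff]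
  simp only [lt_top_iff_ne_top, ne_eq]

end

noncomputable def cubeF (d n : ℕ) : Finset (Idx d) := Fintype.piFinset fun _ => Finset.Icc 0 (n : ℤ)

lemma mem_cubeF {d n : ℕ} (t : Idx d) : t ∈ cubeF d n ↔ t ∈ cube d n := by
  simp [cubeF, cube]

lemma card_cubeF (d n : ℕ) : (cubeF d n).card = (n + 1) ^ d := by
  simp [cubeF]

noncomputable def cmax {d : ℕ} (n : ℕ) (f : Fld d) : ℝ≥0∞ := ⨆ t ∈ cube d n, (f t : ℝ≥0∞)

lemma meas_cmax {d n : ℕ} : Measurable (cmax (d := d) n) := by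
  unfold cmax
  refine Measurable.iSup fun t => Measurable.iSup fun _ => ?_
  fun_prop

lemma cmax_smul {d n : ℕ} (c : ℝ≥0) (f : Fld d) :
    cmax n (fun t => c * f t) = c * cmax n f := by
  simp [cmax, ENNReal.mul_iSup]

section
variable {d : ℕ} {Ω : Type*} [MeasurableSpace Ω]
    {P : Measure Ω} {Z : Ω → Fld d}

lemma lower_bound (hZ : IsBRS P Z) (n : ℕ) :
    ((n + 1 : ℕ) : ℝ≥0∞) ^ d * ∫⁻ ω, (Z ω 0 : ℝ≥0∞) * (Z ω 0 * (T (Z ω))⁻¹) ∂P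
      ≤ cubeMaxExp P Z n := by
  set F : Fld d → ℝ≥0∞ := fun f => cmax n f * (T f)⁻¹ with hF
  have hFm : Measurable F := meas_cmax.mul meas_T.inv
  have hFh : Homog0 F := by
    intro c hc f
    simp only [hF, cmax_smul, T_smul, ← div_eq_mul_inv]
    exact ENNReal.mul_div_mul_left _ _ (by simpa using hc.ne') (by simp)
  have h1 : ∫⁻ ω, ∑ t ∈ cubeF d n, (Z ω t : ℝ≥0∞) * F (Z ω) ∂P ≤ cubeMaxExp P Z n := by
    refine lintegral_mono fun ω => ?_
    change _ ≤ cmax n (Z ω)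
    rw [← Finset.sum_mul]
    calc _ ≤ T (Z ω) * F (Z ω) := by
            gcongr; exact ENNReal.sum_le_tsum _
      _ = cmax n (Z ω) * (T (Z ω) * (T (Z ω))⁻¹) := by simp only [hF]; ring
      _ ≤ cmax n (Z ω) * 1 := by gcongr; exact ENNReal.mul_inv_le_one _
      _ = _ := mul_one _
  refine le_trans ?_ h1
  rw [lintegral_finsetSum _ fun t _ => meas_ZG hZ t hFm]
  have h2 : ∀ t ∈ cubeF d n, ∫⁻ ω, (Z ω 0 : ℝ≥0∞) * (Z ω 0 * (T (Z ω))⁻¹) ∂P ≤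
      ∫⁻ ω, (Z ω t : ℝ≥0∞) * F (Z ω) ∂P := by
    intro t ht
    rw [hZ.tilt_shift t F hFm hFh]
    refine lintegral_mono fun ω => ?_
    simp only [hF, T_shift]
    gcongr
    have : (Z ω 0 : ℝ≥0∞) = (shift t (Z ω) t : ℝ≥0∞) := by simp [shift]
    rw [this]
    exact le_iSup₂_of_le t ((mem_cubeF t).1 ht) le_rfl
  have := Finset.card_nsmul_le_sum _ _ _ h2
  rw [card_cubeF, nsmul_eq_mul] at this
  push_cast at this ⊢
  exact this

lemma inf_of_H (hZ : IsBRS P Z) (hZpos : ∀ᵐ ω ∂P, ∃ t, 0 < Z ω t)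
    (hH : Tendsto (fun n : ℕ => cubeMaxExp P Z n / (n : ℝ≥0∞) ^ d) atTop (nhds 0)) :
    ∀ᵐ ω ∂P, T (Z ω) = ∞ := by
  set b := ∫⁻ ω, (Z ω 0 : ℝ≥0∞) * (Z ω 0 * (T (Z ω))⁻¹) ∂P with hb
  have hb0 : b = 0 := by
    refine le_antisymm (ge_of_tendsto hH ?_) bot_le
    filter_upwards [eventually_gt_atTop 0] with n hn
    rw [ENNReal.le_div_iff_mul_le (by left; positivity) (by left; simp)]
    refine le_trans ?_ (lower_bound hZ n)
    rw [mul_comm]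
    gcongr
    simp
  rw [key_iff hZ hZpos]
  have h3 := (lintegral_eq_zero_iff ((meas_Zt hZ 0).mul
    ((meas_Zt hZ 0).mul (meas_T.comp hZ.meas).inv))).1 hb0
  rw [lintegral_eq_zero_iff (meas_ZG hZ 0 meas_finInd)]
  filter_upwards [h3] with ω hω
  simp only [Pi.mul_apply, Pi.zero_apply, mul_eq_zero, Pi.inv_apply, Function.comp,
    ENNReal.inv_eq_zero] at hω
  simp only [Pi.zero_apply, mul_eq_zero, finInd_eq_zero]
  tauto

end

def FA {d : ℕ} (K : Set (Idx d)) (t : Idx d) (f : Fld d) : Prop :=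
  ∀ s ∈ K, f s < f t ∨ (f s = f t ∧ toLex t ≤ toLex s)

lemma measSet_FA {d : ℕ} (K : Set (Idx d)) (t : Idx d) : MeasurableSet {f : Fld d | FA K t f} := by
  unfold FA
  simp only [Set.ofPred_forall]
  refine MeasurableSet.iInter fun s => MeasurableSet.iInter fun _ => ?_
  refine (measurableSet_lt (measurable_pi_apply s) (measurable_pi_apply t)).union ?_
  exact (measurableSet_eq_fun (measurable_pi_apply s) (measurable_pi_apply t)).inter
    (MeasurableSet.const _)

noncomputable def faInd {d : ℕ} (K : Set (Idx d)) (t : Idx d) (f : Fld d) : ℝ≥0∞ :=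
  {f : Fld d | FA K t f}.indicator (fun _ => (1 : ℝ≥0∞)) f

lemma meas_faInd {d : ℕ} (K : Set (Idx d)) (t : Idx d) : Measurable (faInd K t) :=
  measurable_const.indicator (measSet_FA K t)

lemma faInd_congr {d : ℕ} {K K' : Set (Idx d)} {t t' : Idx d} {f f' : Fld d}
    (h : FA K t f ↔ FA K' t' f') : faInd K t f = faInd K' t' f' := by
  by_cases h1 : FA K t f
  · simp [faInd, Set.indicator, h1, h.1 h1]
  · simp [faInd, Set.indicator, h1, (not_congr h).1 h1]

lemma faInd_mono {d : ℕ} {K K' : Set (Idx d)} {t : Idx d} {f : Fld d}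
    (h : K ⊆ K') : faInd K' t f ≤ faInd K t f := by
  by_cases h1 : FA K' t f
  · have : FA K t f := fun s hs => h1 s (h hs)
    simp [faInd, Set.indicator, this, h1]
  · simp [faInd, Set.indicator, h1]

lemma faInd_le_one {d : ℕ} {K : Set (Idx d)} {t : Idx d} {f : Fld d} : faInd K t f ≤ 1 := by
  by_cases h1 : FA K t f <;> simp [faInd, Set.indicator, h1]

lemma homog_faInd {d : ℕ} (K : Set (Idx d)) (t : Idx d) : Homog0 (faInd K t) := by
  intro c hc f
  apply faInd_congr
  unfold FA
  simp only [mul_lt_mul_iff_right₀ hc, mul_right_inj' hc.ne']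

lemma FA_shift {d : ℕ} (K : Set (Idx d)) (t h : Idx d) (f : Fld d) :
    FA K t (shift h f) ↔ FA {s | s + h ∈ K} (t - h) f := by
  unfold FA shift
  constructor
  · intro H s hs
    have := H _ hs
    simp only [add_sub_cancel_right] at this
    refine this.imp id fun h2 => ⟨h2.1, ?_⟩
    have h3 := sub_le_sub_right h2.2 (toLex h)
    rw [← toLex_sub, ← toLex_sub] at h3
    simpa using h3
  · intro H s hs
    have := H (s - h) (by simpa using hs)
    refine this.imp id fun h2 => ⟨h2.1, ?_⟩
    have h3 := add_le_add_left h2.2 (toLex h)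
    rw [← toLex_add, ← toLex_add] at h3
    simpa using h3

lemma FA_unique {d : ℕ} {t s : Idx d} {f : Fld d} (ht : FA Set.univ t f)
    (hs : FA Set.univ s f) : t = s := by
  rcases ht s trivial with h | h
  · rcases hs t trivial with h2 | h2
    · exact absurd h h2.not_gt
    · exact absurd h2.1 h.ne'
  · rcases hs t trivial with h2 | h2
    · exact absurd h.1 h2.ne'
    · exact toLex.injective (le_antisymm h.2 h2.2)

lemma FA_exists {d : ℕ} (K : Finset (Idx d)) (hK : K.Nonempty) (f : Fld d) :
    ∃ t ∈ K, FA (K : Set (Idx d)) t f := by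
  obtain ⟨t, ht, hmax⟩ := K.exists_max_image
    (fun t => (toLex (f t, OrderDual.toDual (toLex t)) : ℝ≥0 ×ₗ (Lex (Idx d))ᵒᵈ)) hK
  refine ⟨t, ht, fun s hs => ?_⟩
  have := hmax s hs
  rw [Prod.Lex.toLex_le_toLex] at this
  simpa using this

lemma cmax_le {d n : ℕ} (f : Fld d) :
    cmax n f ≤ ∑ t ∈ cubeF d n, (f t : ℝ≥0∞) * faInd (cube d n) t f := by
  have hK : (cubeF d n).Nonempty := ⟨0, by simp [cubeF]⟩
  have hc : ((cubeF d n : Finset (Idx d)) : Set (Idx d)) = cube d n := by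
    ext t; simp [mem_cubeF]
  obtain ⟨t, ht, hfa⟩ := FA_exists (cubeF d n) hK f
  rw [hc] at hfa
  refine le_trans ?_ (Finset.single_le_sum (f := fun t => (f t : ℝ≥0∞) * faInd (cube d n) t f)
    (fun _ _ => bot_le) ht)
  have : faInd (cube d n) t f = 1 := by simp [faInd, Set.indicator, hfa]
  simp only [this, mul_one]
  refine iSup₂_le fun s hs => ?_
  rcases hfa s hs with h | h
  · exact_mod_cast h.le
  · exact_mod_cast h.1.le

def box (d m : ℕ) : Set (Idx d) := {s | ∀ j, |s j| ≤ (m : ℤ)}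

section
variable {d : ℕ} {Ω : Type*} [MeasurableSpace Ω]
    {P : Measure Ω} {Z : Ω → Fld d}

lemma upper1 (hZ : IsBRS P Z) (n : ℕ) :
    cubeMaxExp P Z n ≤ ∑ t ∈ cubeF d n,
      ∫⁻ ω, (Z ω 0 : ℝ≥0∞) * faInd {s | s + t ∈ cube d n} 0 (Z ω) ∂P := by
  calc cubeMaxExp P Z n
      ≤ ∫⁻ ω, ∑ t ∈ cubeF d n, (Z ω t : ℝ≥0∞) * faInd (cube d n) t (Z ω) ∂P :=
        lintegral_mono fun ω => cmax_le (Z ω)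
    _ = ∑ t ∈ cubeF d n, ∫⁻ ω, (Z ω t : ℝ≥0∞) * faInd (cube d n) t (Z ω) ∂P :=
        lintegral_finsetSum _ fun t _ => meas_ZG hZ t (meas_faInd _ _)
    _ = _ := by
        refine Finset.sum_congr rfl fun t _ => ?_
        rw [hZ.tilt_shift t _ (meas_faInd _ _) (homog_faInd _ _)]
        refine lintegral_congr fun ω => ?_
        congr 1
        apply faInd_congr
        rw [FA_shift, sub_self]

lemma term_le_one (hZ : IsBRS P Z) (K : Set (Idx d)) :
    ∫⁻ ω, (Z ω 0 : ℝ≥0∞) * faInd K 0 (Z ω) ∂P ≤ 1 := by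
  rw [← hZ.mean_one 0]
  refine lintegral_mono fun ω => ?_
  exact mul_le_of_le_one_right' faInd_le_one

noncomputable def inner (d m n : ℕ) : Finset (Idx d) :=
  Fintype.piFinset fun _ => Finset.Icc (m : ℤ) ((n : ℤ) - m)

lemma inner_sub (d m n : ℕ) : inner d m n ⊆ cubeF d n := by
  intro t ht
  simp only [inner, cubeF, Fintype.mem_piFinset, Finset.mem_Icc] at *
  intro j
  have := ht j
  omega

lemma card_inner (d m n : ℕ) : (inner d m n).card = (n + 1 - 2 * m) ^ d := by
  simp only [inner, Fintype.card_piFinset, Int.card_Icc, Finset.prod_const, Finset.card_univ,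
    Fintype.card_fin]
  congr 1
  omega

lemma upper2 (hZ : IsBRS P Z) (m n : ℕ) :
    cubeMaxExp P Z n ≤ ((n + 1) ^ d : ℕ) *
      (∫⁻ ω, (Z ω 0 : ℝ≥0∞) * faInd (box d m) 0 (Z ω) ∂P)
      + ((n + 1) ^ d - (n + 1 - 2 * m) ^ d : ℕ) := by
  refine (upper1 hZ n).trans ?_
  rw [← Finset.sum_sdiff (inner_sub d m n), add_comm]
  refine add_le_add ?_ ?_
  · refine (Finset.sum_le_card_nsmul _ _
      (∫⁻ ω, (Z ω 0 : ℝ≥0∞) * faInd (box d m) 0 (Z ω) ∂P) ?_).trans ?_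
    · intro t ht
      refine lintegral_mono fun ω => ?_
      gcongr
      apply faInd_mono
      intro s hs j
      have h1 := hs j
      simp only [inner, Fintype.mem_piFinset, Finset.mem_Icc] at ht
      have h2 := ht j
      rw [abs_le] at h1
      simp only [Pi.add_apply]
      omega
    · rw [nsmul_eq_mul]
      gcongr
      rw [← card_cubeF]
      exact Finset.card_le_card (inner_sub d m n)
  · refine (Finset.sum_le_card_nsmul _ _ 1 fun t _ => term_le_one hZ _).trans ?_
    rw [nsmul_eq_mul, mul_one, Finset.card_sdiff_of_subset (inner_sub d m n), card_cubeF,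
      card_inner]

lemma tendsto_shift_pow (d : ℕ) (c : ℝ) :
    Tendsto (fun n : ℕ => ((n : ℝ) + c) ^ d / (n : ℝ) ^ d) atTop (nhds 1) := by
  have h0 : Tendsto (fun n : ℕ => (1 + c / (n : ℝ)) ^ d) atTop (nhds 1) := by
    have := ((tendsto_const_div_atTop_nhds_zero_nat c).const_add 1).pow d
    simpa using this
  refine h0.congr' ?_
  filter_upwards [eventually_gt_atTop 0] with n hn
  have : (n : ℝ) ≠ 0 := by positivity
  rw [← div_pow]
  congr 1
  field_simp

lemma nat_div_eq (a n d : ℕ) (hn : 0 < n) :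
    (a : ℝ≥0∞) / (n : ℝ≥0∞) ^ d = ENNReal.ofReal ((a : ℝ) / (n : ℝ) ^ d) := by
  rw [ENNReal.ofReal_div_of_pos (by positivity), ENNReal.ofReal_pow (by positivity)]
  simp

lemma upper3 (hZ : IsBRS P Z) (m : ℕ) (H : ℝ≥0∞)
    (hH : Tendsto (fun n : ℕ => cubeMaxExp P Z n / (n : ℝ≥0∞) ^ d) atTop (nhds H)) :
    H ≤ ∫⁻ ω, (Z ω 0 : ℝ≥0∞) * faInd (box d m) 0 (Z ω) ∂P := by
  set a := ∫⁻ ω, (Z ω 0 : ℝ≥0∞) * faInd (box d m) 0 (Z ω) ∂P with ha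
  have ha1 : a ≤ 1 := term_le_one hZ _
  have hu : Tendsto (fun n : ℕ => (((n + 1) ^ d : ℕ) : ℝ≥0∞) / (n : ℝ≥0∞) ^ d) atTop (nhds 1) := by
    have := ENNReal.tendsto_ofReal (tendsto_shift_pow d 1)
    rw [ENNReal.ofReal_one] at this
    refine this.congr' ?_
    filter_upwards [eventually_gt_atTop 0] with n hn
    rw [nat_div_eq _ _ _ hn]
    push_cast
    rfl
  have hv : Tendsto (fun n : ℕ => (((n + 1) ^ d - (n + 1 - 2 * m) ^ d : ℕ) : ℝ≥0∞) /
      (n : ℝ≥0∞) ^ d) atTop (nhds 0) := by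
    have := ENNReal.tendsto_ofReal ((tendsto_shift_pow d 1).sub (tendsto_shift_pow d (1 - 2 * m)))
    rw [sub_self, ENNReal.ofReal_zero] at this
    refine this.congr' ?_
    filter_upwards [eventually_gt_atTop (2 * m)] with n hn
    rw [nat_div_eq _ _ _ (by omega), Nat.cast_sub (Nat.pow_le_pow_left (by omega) d),
      sub_div]
    push_cast [Nat.cast_sub (show 2 * m ≤ n + 1 by omega)]
    congr 4
    ring
  have hlim : Tendsto (fun n : ℕ => (((n + 1) ^ d : ℕ) : ℝ≥0∞) / (n : ℝ≥0∞) ^ d * a +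
      (((n + 1) ^ d - (n + 1 - 2 * m) ^ d : ℕ) : ℝ≥0∞) / (n : ℝ≥0∞) ^ d) atTop
      (nhds (1 * a + 0)) := by
    refine Tendsto.add ?_ hv
    exact ENNReal.Tendsto.mul_const hu (Or.inl one_ne_zero)
  rw [one_mul, add_zero] at hlim
  refine le_of_tendsto_of_tendsto' hH hlim fun n => ?_
  refine (ENNReal.div_le_div_right (upper2 hZ m n) _).trans_eq ?_
  rw [ENNReal.add_div]
  congr 1
  rw [div_eq_mul_inv, div_eq_mul_inv]
  ring

lemma upper4 (hZ : IsBRS P Z) (H : ℝ≥0∞)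
    (hH : Tendsto (fun n : ℕ => cubeMaxExp P Z n / (n : ℝ≥0∞) ^ d) atTop (nhds H)) :
    H ≤ ∫⁻ ω, (Z ω 0 : ℝ≥0∞) * faInd Set.univ 0 (Z ω) ∂P := by
  have hlim : Tendsto (fun m : ℕ => ∫⁻ ω, (Z ω 0 : ℝ≥0∞) * faInd (box d m) 0 (Z ω) ∂P) atTop
      (nhds (∫⁻ ω, (Z ω 0 : ℝ≥0∞) * faInd Set.univ 0 (Z ω) ∂P)) := by
    refine tendsto_lintegral_of_dominated_convergence (fun ω => (Z ω 0 : ℝ≥0∞))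
      (fun m => meas_ZG hZ 0 (meas_faInd _ _)) ?_ ?_ ?_
    · intro m
      exact Eventually.of_forall fun ω => mul_le_of_le_one_right' faInd_le_one
    · rw [hZ.mean_one]; simp
    · refine Eventually.of_forall fun ω => ?_
      refine tendsto_const_nhds.congr' ?_
      by_cases h : FA Set.univ 0 (Z ω)
      · refine Eventually.of_forall fun m => ?_
        beta_reduce
        congr 1
        apply faInd_congr
        exact ⟨fun _ s _ => h s trivial, fun _ => h⟩
      · have h' := h
        unfold FA at h'
        push Not at h'
        obtain ⟨s, _, hs⟩ := h'
        obtain ⟨M, hM⟩ : ∃ M : ℕ, s ∈ box d M := by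
          refine ⟨∑ j, (s j).natAbs, fun j => ?_⟩
          rw [Int.abs_eq_natAbs]
          exact_mod_cast Finset.single_le_sum (f := fun j => (s j).natAbs)
            (fun _ _ => Nat.zero_le _) (Finset.mem_univ j)
        filter_upwards [eventually_ge_atTop M] with m hm
        congr 1
        apply faInd_congr
        refine ⟨fun h2 => absurd h2 h, fun h2 => ?_⟩
        have hsm : s ∈ box d m := fun j => (hM j).trans (by exact_mod_cast hm)
        rcases h2 s hsm with h3 | h3
        · exact absurd h3 hs.1.not_gt
        · exact absurd h3.2 (hs.2 h3.1).not_ge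
  exact ge_of_tendsto' hlim fun m => upper3 hZ m H hH

lemma H_of_inf (hZ : IsBRS P Z) (H : ℝ≥0∞)
    (hH : Tendsto (fun n : ℕ => cubeMaxExp P Z n / (n : ℝ≥0∞) ^ d) atTop (nhds H))
    (hinf : ∀ᵐ ω ∂P, T (Z ω) = ∞) : H = 0 := by
  refine le_antisymm ((upper4 hZ H hH).trans_eq ?_) bot_le
  have h1 : ∫⁻ ω, T (Z ω) * faInd Set.univ 0 (Z ω) ∂P ≤ 1 := by
    calc ∫⁻ ω, T (Z ω) * faInd Set.univ 0 (Z ω) ∂P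
        = ∫⁻ ω, ∑' h : Idx d, (Z ω h : ℝ≥0∞) * faInd Set.univ 0 (Z ω) ∂P := by
          refine lintegral_congr fun ω => ?_
          rw [ENNReal.tsum_mul_right]; rfl
      _ = ∑' h : Idx d, ∫⁻ ω, (Z ω h : ℝ≥0∞) * faInd Set.univ 0 (Z ω) ∂P :=
          lintegral_tsum fun h => (meas_ZG hZ h (meas_faInd _ _)).aemeasurable
      _ = ∑' h : Idx d, ∫⁻ ω, (Z ω 0 : ℝ≥0∞) * faInd Set.univ (-h) (Z ω) ∂P := by
          congr 1
          ext h
          rw [hZ.tilt_shift h _ (meas_faInd _ _) (homog_faInd _ _)]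
          refine lintegral_congr fun ω => ?_
          congr 1
          apply faInd_congr
          rw [FA_shift, zero_sub]
          simp
      _ = ∫⁻ ω, ∑' h : Idx d, (Z ω 0 : ℝ≥0∞) * faInd Set.univ (-h) (Z ω) ∂P :=
          (lintegral_tsum fun h => (meas_ZG hZ 0 (meas_faInd _ _)).aemeasurable).symm
      _ ≤ ∫⁻ ω, (Z ω 0 : ℝ≥0∞) ∂P := by
          refine lintegral_mono fun ω => ?_
          rw [ENNReal.tsum_mul_left]
          refine mul_le_of_le_one_right' ?_
          by_cases hex : ∃ h, FA Set.univ (-h) (Z ω)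
          · obtain ⟨h, hh⟩ := hex
            rw [tsum_eq_single h]
            · exact faInd_le_one
            · intro h' hne
              have : ¬ FA Set.univ (-h') (Z ω) := fun h2 => hne (neg_injective (FA_unique h2 hh))
              simp [faInd, Set.indicator, this]
          · push Not at hex
            have : ∀ h, faInd Set.univ (-h) (Z ω) = 0 := fun h => by
              simp [faInd, Set.indicator, hex h]
            simp [this]
      _ = 1 := hZ.mean_one 0
  have h2 := ae_lt_top ((meas_T.mul (meas_faInd Set.univ 0)).comp hZ.meas)
    (ne_top_of_le_ne_top ENNReal.one_ne_top h1)
  rw [lintegral_eq_zero_iff (meas_ZG hZ 0 (meas_faInd _ _))]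
  filter_upwards [h2, hinf] with ω h3 h4
  simp only [Function.comp, Pi.mul_apply, h4] at h3
  have : faInd Set.univ 0 (Z ω) = 0 := by
    by_contra hne
    rw [ENNReal.top_mul hne] at h3
    exact lt_irrefl _ h3
  simp [this]

end

lemma pareto_map {Ω' : Type*} [MeasurableSpace Ω'] (Q : Measure Ω') [IsProbabilityMeasure Q]
    (R : Ω' → ℝ≥0) (hR : IsUnitPareto Q R) :
    Q.map (fun ω => (R ω : ℝ)) = ProbabilityTheory.paretoMeasure 1 1 := by
  have hRm : Measurable (fun ω => (R ω : ℝ)) := measurable_coe_nnreal_real.comp hR.1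
  have : IsProbabilityMeasure (Q.map (fun ω => (R ω : ℝ))) :=
    Measure.isProbabilityMeasure_map hRm.aemeasurable
  have : IsProbabilityMeasure (ProbabilityTheory.paretoMeasure 1 1) :=
    ProbabilityTheory.isProbabilityMeasure_paretoMeasure one_pos one_pos
  have hp : ∀ x : ℝ, 1 ≤ x →
      ProbabilityTheory.paretoMeasure 1 1 (Set.Ioi x) = ENNReal.ofReal x⁻¹ := by
    intro x hx
    rw [ProbabilityTheory.paretoMeasure, withDensity_apply _ measurableSet_Ioi]
    have h1 : ∫⁻ y in Set.Ioi x, ProbabilityTheory.paretoPDF 1 1 y =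
        ∫⁻ y in Set.Ioi x, ENNReal.ofReal (y ^ (-2 : ℝ)) := by
      refine setLIntegral_congr_fun measurableSet_Ioi fun y hy => ?_
      rw [ProbabilityTheory.paretoPDF_of_le (hx.trans (le_of_lt hy))]
      norm_num
    have hx0 : 0 < x := by linarith
    rw [h1, ← ofReal_integral_eq_lintegral_ofReal
      (integrableOn_Ioi_rpow_of_lt (by norm_num) hx0), integral_Ioi_rpow_of_lt (by norm_num) hx0]
    · congr 1
      norm_num [Real.rpow_neg_one]
    · filter_upwards [ae_restrict_mem measurableSet_Ioi] with y hy
      have : 0 < y := hx0.trans hy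
      simp only [Pi.zero_apply]
      positivity
  have hq : ∀ x : ℝ, 1 ≤ x →
      Q.map (fun ω => (R ω : ℝ)) (Set.Ioi x) = ENNReal.ofReal x⁻¹ := by
    intro x hx
    rw [Measure.map_apply hRm measurableSet_Ioi]
    exact hR.2 x hx
  have hone : ∀ (μ : Measure ℝ) [IsProbabilityMeasure μ], μ (Set.Ioi 1) = ENNReal.ofReal (1:ℝ)⁻¹ →
      ∀ x : ℝ, x ≤ 1 → μ (Set.Ioi x) = 1 := by
    intro μ _ h x hx
    refine le_antisymm prob_le_one ?_
    calc (1 : ℝ≥0∞) = μ (Set.Ioi 1) := by rw [h]; simp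
      _ ≤ _ := measure_mono (Set.Ioi_subset_Ioi hx)
  refine Measure.ext_of_Iic _ _ fun x => ?_
  rw [← Set.compl_Ioi, prob_compl_eq_one_sub measurableSet_Ioi,
    prob_compl_eq_one_sub measurableSet_Ioi]
  congr 1
  rcases le_total 1 x with hx | hx
  · rw [hp x hx, hq x hx]
  · rw [hone _ (hp 1 le_rfl) x hx, hone _ (hq 1 le_rfl) x hx]

lemma pareto_scale {Ω' : Type*} [MeasurableSpace Ω'] (Q : Measure Ω') [IsProbabilityMeasure Q]
    (R : Ω' → ℝ≥0) (hR : IsUnitPareto Q R) (N : Set ℝ≥0) (hN : MeasurableSet N)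
    (h0 : Q {ω | R ω ∈ N} = 0) (c : ℝ≥0) (hc : 0 < c) :
    Q {ω | c * R ω ∈ N ∧ 1 ≤ c * R ω} = 0 := by
  have hRm : Measurable (fun ω => (R ω : ℝ)) := measurable_coe_nnreal_real.comp hR.1
  set N' : Set ℝ := Real.toNNReal ⁻¹' N with hN'
  have hN'm : MeasurableSet N' := measurable_real_toNNReal hN
  have h1 : ProbabilityTheory.paretoMeasure 1 1 N' = 0 := by
    rw [← pareto_map Q R hR, Measure.map_apply hRm hN'm, ← h0]
    congr 1
    ext ω
    simp [hN']
  have hpm : Measurable (ProbabilityTheory.paretoPDF 1 1) :=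
    (ProbabilityTheory.measurable_paretoPDFReal 1 1).ennreal_ofReal
  rw [ProbabilityTheory.paretoMeasure, withDensity_apply_eq_zero hpm] at h1
  have h2 : volume (N' ∩ Set.Ici 1) = 0 := by
    refine measure_mono_null ?_ h1
    rintro x ⟨hx, hx1⟩
    refine ⟨?_, hx⟩
    have := ProbabilityTheory.paretoPDFReal_pos one_pos one_pos hx1
    simpa [ProbabilityTheory.paretoPDF] using this
  have h3 : volume ((fun x : ℝ => (c : ℝ) * x) ⁻¹' (N' ∩ Set.Ici 1)) = 0 := by
    rw [Real.volume_preimage_mul_left (by exact_mod_cast hc.ne'), h2, mul_zero]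
  have h4 : ProbabilityTheory.paretoMeasure 1 1
      ((fun x : ℝ => (c : ℝ) * x) ⁻¹' (N' ∩ Set.Ici 1)) = 0 :=
    withDensity_absolutelyContinuous _ _ h3
  rw [← pareto_map Q R hR, Measure.map_apply hRm
    ((measurable_const_mul _) (hN'm.inter measurableSet_Ici))] at h4
  refine measure_mono_null ?_ h4
  rintro ω ⟨h5, h6⟩
  refine ⟨?_, ?_⟩
  · simp only [hN', Set.mem_preimage]
    rw [← NNReal.coe_mul, Real.toNNReal_coe]
    exact h5
  · simp only [Set.mem_Ici]
    exact_mod_cast h6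

section
variable {d : ℕ} {Ω Ω' : Type*} [MeasurableSpace Ω] [MeasurableSpace Ω']
    {P : Measure Ω} {Q : Measure Ω'} {Z : Ω → Fld d} {Θ : Ω' → Fld d} {R : Ω' → ℝ≥0}

/-- probability of the event `R • g ∈ A` for a fixed field `g` -/
noncomputable def radial (Q : Measure Ω') (R : Ω' → ℝ≥0) (A : Set (Fld d)) (g : Fld d) : ℝ≥0∞ :=
  Q {ω | (fun t => R ω * g t) ∈ A}

lemma meas_smulpair : Measurable fun p : Fld d × ℝ≥0 => (fun t => p.2 * p.1 t : Fld d) := by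
  refine measurable_pi_lambda _ fun t => ?_
  exact measurable_snd.mul ((measurable_pi_apply t).comp measurable_fst)

lemma radial_eq (hR : Measurable R) {A : Set (Fld d)} (hA : MeasurableSet A) (g : Fld d) :
    radial Q R A g = Q.map R (Prod.mk g ⁻¹' ((fun p : Fld d × ℝ≥0 =>
      (fun t => p.2 * p.1 t : Fld d)) ⁻¹' A)) := by
  rw [Measure.map_apply hR (measurable_prodMk_left (meas_smulpair hA))]
  rfl

lemma meas_radial [IsProbabilityMeasure Q] (hR : Measurable R) {A : Set (Fld d)}
    (hA : MeasurableSet A) : Measurable (radial Q R A) := by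
  have : IsProbabilityMeasure (Q.map R) := Measure.isProbabilityMeasure_map hR.aemeasurable
  have := measurable_measure_prodMk_left (ν := Q.map R) (meas_smulpair hA)
  have h2 : radial Q R A = _ := funext fun g => radial_eq hR hA g
  rw [h2]
  exact this

lemma law_Y [IsProbabilityMeasure Q] (hZ : IsBRS P Z) (hΘ : IsSpectralTail P Z Q Θ)
    (hR : Measurable R) (hRΘ : ProbabilityTheory.IndepFun R Θ Q)
    {A : Set (Fld d)} (hA : MeasurableSet A) :
    Q {ω | (fun t => R ω * Θ ω t) ∈ A} =
      ∫⁻ ω, (Z ω 0 : ℝ≥0∞) * radial Q R A (fun t => Z ω t / Z ω 0) ∂P := by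
  have : IsProbabilityMeasure (Q.map R) := Measure.isProbabilityMeasure_map hR.aemeasurable
  rw [← tail_lintegral hZ hΘ _ (meas_radial hR hA)]
  have hprod := (ProbabilityTheory.indepFun_iff_map_prod_eq_prod_map_map hΘ.1.aemeasurable
    hR.aemeasurable).1 hRΘ.symm
  have h1 : Q {ω | (fun t => R ω * Θ ω t) ∈ A} = Q.map (fun ω => (Θ ω, R ω))
      ((fun p : Fld d × ℝ≥0 => (fun t => p.2 * p.1 t : Fld d)) ⁻¹' A) := by
    rw [Measure.map_apply (hΘ.1.prodMk hR) (meas_smulpair hA)]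
    rfl
  rw [h1, hprod, Measure.prod_apply (meas_smulpair hA), ← lintegral_map (meas_radial hR hA) hΘ.1]
  refine lintegral_congr fun g => ?_
  rw [radial_eq hR hA]

lemma pareto_gt_one [IsProbabilityMeasure Q] (hR : IsUnitPareto Q R) : ∀ᵐ ω ∂Q, 1 < R ω := by
  have h3 := hR.2 1 le_rfl
  rw [inv_one, ENNReal.ofReal_one] at h3
  have hm : MeasurableSet {ω | (1 : ℝ) < R ω} :=
    measurableSet_lt measurable_const (measurable_coe_nnreal_real.comp hR.1)
  have h4 := (prob_compl_eq_zero_iff hm).2 h3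
  rw [ae_iff]
  rw [← h4]
  congr 1

def ev {d : ℕ} (I : Fld d → Option (Idx d)) (i : Idx d) : Set (Fld d) :=
  {f | I f = some i ∧ T f < ∞}

lemma meas_ev {I : Fld d → Option (Idx d)} (hI : Anchoring I) (i : Idx d) :
    MeasurableSet (ev I i) := (hI.meas i).inter measSet_fin

lemma ev_shift {I : Fld d → Option (Idx d)} (hI : Anchoring I) (h : Idx d) (f : Fld d) :
    shift h f ∈ ev I h ↔ f ∈ ev I 0 := by
  simp only [ev, Set.mem_ofPred_eq, T_shift]
  refine and_congr_left fun _ => ⟨fun h1 => ?_, fun h1 => ?_⟩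
  · have := hI.shift_rel _ _ (-h) h1
    have h2 : shift (-h) (shift h f) = f := by
      ext t; simp [shift]
    rw [h2] at this
    simpa using this
  · have := hI.shift_rel _ _ h h1
    simpa using this

lemma anchor_null [IsProbabilityMeasure Q] (hZ : IsBRS P Z) (hΘ : IsSpectralTail P Z Q Θ)
    (hR : IsUnitPareto Q R) (hRΘ : ProbabilityTheory.IndepFun R Θ Q)
    {I : Fld d → Option (Idx d)} (hI : Anchoring I)
    (h0 : Q {ω | (fun t => R ω * Θ ω t) ∈ ev I 0} = 0) (h : Idx d) :
    Q {ω | (fun t => R ω * Θ ω t) ∈ ev I h} = 0 := by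
  rw [law_Y hZ hΘ hR.1 hRΘ (meas_ev hI _)] at h0 ⊢
  set F : Fld d → ℝ≥0∞ := fun f => radial Q R (ev I h) (fun t => f t / f h) with hF
  have hdiv : ∀ s : Idx d, Measurable fun f : Fld d => (fun t => f t / f s : Fld d) := fun s =>
    measurable_pi_lambda _ fun t => (measurable_pi_apply t).div (measurable_pi_apply s)
  have hFm : Measurable F := (meas_radial hR.1 (meas_ev hI h)).comp (hdiv h)
  have hFh : Homog0 F := by
    intro c hc f
    simp only [hF]
    congr 1
    ext t
    rw [mul_div_mul_left _ _ hc.ne']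
  have h1 := hZ.tilt_shift h F hFm hFh
  have h2 : ∀ f : Fld d, F (shift h f) = radial Q R (ev I 0) (fun t => f t / f 0) := by
    intro f
    simp only [hF, radial]
    congr 1
    ext ω
    simp only [Set.mem_ofPred_eq]
    rw [← ev_shift hI h]
    simp only [shift, sub_self]
    rfl
  simp_rw [h2] at h1
  rw [h0, lintegral_eq_zero_iff (meas_ZG hZ h hFm)] at h1
  rw [lintegral_eq_zero_iff (meas_ZG hZ 0 (G := fun f => radial Q R (ev I h) (fun t => f t / f 0))
    ((meas_radial hR.1 (meas_ev hI h)).comp (hdiv 0)))]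
  have hR1 := pareto_gt_one hR
  filter_upwards [h1] with ω hω
  simp only [Pi.zero_apply, mul_eq_zero] at hω ⊢
  by_cases hz0 : Z ω 0 = 0
  · left; simp [hz0]
  right
  have hz0' : 0 < Z ω 0 := pos_iff_ne_zero.2 hz0
  have hlow : ∀ r : ℝ≥0, 1 < r → (fun t => r * (Z ω t / Z ω 0) : Fld d) ∈ ev I h →
      1 ≤ r * (Z ω h / Z ω 0) := by
    intro r hr hmem
    have := hI.lower _ _ hmem.1
    rw [div_self hz0, mul_one, min_eq_right hr.le] at this
    exact this
  by_cases hzh : Z ω h = 0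
  · refine measure_eq_zero_iff_ae_notMem.2 ?_
    filter_upwards [hR1] with ω' h10 h11
    have := hlow _ h10 h11
    simp [hzh] at this
  · have hN : F (Z ω) = 0 := by
      rcases hω with h5 | h5
      · simp [hzh] at h5
      · exact h5
    have hc : 0 < Z ω h / Z ω 0 := by
      have := pos_iff_ne_zero.2 hzh
      positivity
    have h6 := pareto_scale Q R hR {r | (fun t => r * (Z ω t / Z ω h) : Fld d) ∈ ev I h}
      ((measurable_pi_lambda _ fun t => measurable_id.mul_const _) (meas_ev hI h)) hN _ hc
    have h7 : ∀ᵐ ω' ∂Q, ¬ (fun t => R ω' * (Z ω t / Z ω 0) : Fld d) ∈ ev I h := by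
      have h8 := measure_eq_zero_iff_ae_notMem.1 h6
      filter_upwards [h8, hR1] with ω' h9 h10 h11
      refine h9 ⟨?_, ?_⟩
      · change (fun t => _ * (Z ω t / Z ω h) : Fld d) ∈ ev I h
        convert h11 using 2 with t
        field_simp
      · rw [mul_comm]
        exact hlow _ h10 h11
    exact measure_eq_zero_iff_ae_notMem.2 h7

end

end BR

/-- Let `Z` be Brown–Resnick stationary with `E[Z(t)] = 1` and
`max_t Z(t) > 0` a.s., `Θ` its spectral tail field, `R` unit Pareto independent of `Θ`,
`Y = R·Θ`, and let `H_Z` be the Pickands constant of `Z`.  Then `H_Z = 0` iff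
`P(Σ_t Θ(t) = ∞) = P(Σ_t Z(t) = ∞) = 1`; and if `I` is an anchoring map with
`P(I(Y) ∈ ℤ^d, Σ_t Y(t) < ∞) = P(Σ_t Y(t) < ∞)`, then `H_Z = 0` iff
`P(I(Y) = 0, Σ_t Y(t) < ∞) = 0`. -/
theorem stmt5 {d : ℕ} (hd : 0 < d) {Ω Ω' : Type*} [MeasurableSpace Ω] [MeasurableSpace Ω']
    (P : Measure Ω) [IsProbabilityMeasure P] (Q : Measure Ω') [IsProbabilityMeasure Q]
    (Z : Ω → Fld d) (hZ : IsBRS P Z) (hZpos : ∀ᵐ ω ∂P, ∃ t, 0 < Z ω t)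
    (Θ : Ω' → Fld d) (hΘ : IsSpectralTail P Z Q Θ)
    (R : Ω' → ℝ≥0) (hR : IsUnitPareto Q R) (hRΘ : ProbabilityTheory.IndepFun R Θ Q)
    (H : ℝ≥0∞)
    (hH : Tendsto (fun n : ℕ => cubeMaxExp P Z n / (n : ℝ≥0∞) ^ d) atTop (nhds H)) :
    (H = 0 ↔
      (Q {ω | ∑' t : Idx d, (Θ ω t : ℝ≥0∞) = ∞} = 1 ∧
       P {ω | ∑' t : Idx d, (Z ω t : ℝ≥0∞) = ∞} = 1)) ∧
    (∀ I : Fld d → Option (Idx d), Anchoring I →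
      Q {ω | (∃ i, I (fun t => R ω * Θ ω t) = some i) ∧
          ∑' t : Idx d, ((R ω * Θ ω t : ℝ≥0) : ℝ≥0∞) < ∞} =
        Q {ω | ∑' t : Idx d, ((R ω * Θ ω t : ℝ≥0) : ℝ≥0∞) < ∞} →
      (H = 0 ↔
        Q {ω | I (fun t => R ω * Θ ω t) = some 0 ∧
          ∑' t : Idx d, ((R ω * Θ ω t : ℝ≥0) : ℝ≥0∞) < ∞} = 0)) := by
  have hΘm : MeasurableSet {ω | BR.T (Θ ω) = ∞} :=
    hΘ.1 (BR.meas_T (measurableSet_singleton ∞))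
  have hZm : MeasurableSet {ω | BR.T (Z ω) = ∞} :=
    hZ.meas (BR.meas_T (measurableSet_singleton ∞))
  have hQ1 : Q {ω | BR.T (Θ ω) = ∞} = 1 ↔ ∀ᵐ ω ∂Q, BR.T (Θ ω) = ∞ :=
    (prob_compl_eq_zero_iff hΘm).symm
  have hP1 : P {ω | BR.T (Z ω) = ∞} = 1 ↔ ∀ᵐ ω ∂P, BR.T (Z ω) = ∞ :=
    (prob_compl_eq_zero_iff hZm).symm
  have htail := BR.tail_iff hZ hZpos hΘ
  have hmain : H = 0 ↔ ∀ᵐ ω ∂P, BR.T (Z ω) = ∞ :=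
    ⟨fun h => BR.inf_of_H hZ hZpos (h ▸ hH), fun h => BR.H_of_inf hZ H hH h⟩
  refine ⟨?_, fun I hI hcond => ?_⟩
  · change H = 0 ↔ (Q {ω | BR.T (Θ ω) = ∞} = 1 ∧ P {ω | BR.T (Z ω) = ∞} = 1)
    rw [hQ1, hP1, hmain, ← htail, and_self]
  · change H = 0 ↔ Q {ω | (fun t => R ω * Θ ω t) ∈ BR.ev I 0} = 0
    rw [hmain, htail]
    constructor
    · intro h
      rw [measure_eq_zero_iff_ae_notMem]
      filter_upwards [h, BR.pareto_gt_one hR] with ω h1 h2 h3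
      have h4 := (BR.T_smul_lt (R ω) (zero_lt_one.trans h2) (Θ ω)).1 h3.2
      exact h4.ne h1
    · intro h0
      have h1 := fun h => measure_eq_zero_iff_ae_notMem.1
        (BR.anchor_null hZ hΘ hR hRΘ hI h0 h)
      have h2 : ∀ᵐ ω ∂Q, ω ∉ {ω | (∃ i, I (fun t => R ω * Θ ω t) = some i) ∧
          ∑' t : Idx d, ((R ω * Θ ω t : ℝ≥0) : ℝ≥0∞) < ∞} := by
        filter_upwards [ae_all_iff.2 h1] with ω h3 h4
        obtain ⟨⟨i, hi⟩, h5⟩ := h4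
        exact h3 i ⟨hi, h5⟩
      rw [measure_eq_zero_iff_ae_notMem.2 h2] at hcond
      have h3 := measure_eq_zero_iff_ae_notMem.1 hcond.symm
      filter_upwards [h3, BR.pareto_gt_one hR] with ω h4 h5
      by_contra h6
      exact h4 ((BR.T_smul_lt (R ω) (zero_lt_one.trans h5) (Θ ω)).2 (lt_top_iff_ne_top.2 h6))
end

section
/- Let Z be a Brown–Resnick stationary random field with values in E satisfying E[Z(t)] = 1 for all t ∈ ℤ^d and max_{t∈ℤ^d} Z(t) > 0 almost surely, let Θ be its spectral tail field, let R be a unit Pareto random variable independent of Θ, and set Y = R·Θ. Then the classical extremal index H_Z = lim_{n→∞} n^{−d} E[max_{t∈{0,…,n}^d} Z(t)] satisfies H_Z = E[ 1 / Σ_{t∈ℤ^d} 1{Y(t) > 1} ], with the convention 1/∞ = 0 (note that Σ_{t∈ℤ^d} 1{Y(t) > 1} ≥ 1 almost surely since Y(0) = R > 1 almost surely). -/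
open MeasureTheory ENNReal Filter
open scoped NNReal ENNReal

namespace BRAux

open Classical in
/-- number of exceedances in `S` -/
noncomputable def N {d : ℕ} (S : Set (Idx d)) (f : Fld d) (x : ℝ) : ℝ≥0∞ :=
  ∑' s, if s ∈ S ∧ x < (f s : ℝ) then (1 : ℝ≥0∞) else 0

/-- uniform law -/
noncomputable def U : Measure ℝ := volume.restrict (Set.Ioo 0 1)

instance : IsProbabilityMeasure U := ⟨by simp [U]⟩

variable {d : ℕ}

lemma measurable_N (S : Set (Idx d)) : Measurable (fun p : Fld d × ℝ => N S p.1 p.2) := by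
  unfold N
  refine Measurable.ennreal_tsum fun s => ?_
  refine Measurable.ite ?_ measurable_const measurable_const
  refine MeasurableSet.inter (MeasurableSet.const _) (measurableSet_lt measurable_snd ?_)
  fun_prop

lemma N_mono {S T : Set (Idx d)} (h : S ⊆ T) (f : Fld d) (x : ℝ) : N S f x ≤ N T f x := by
  unfold N
  refine ENNReal.tsum_le_tsum fun s => ?_
  by_cases h1 : s ∈ S ∧ x < (f s : ℝ)
  · rw [if_pos h1, if_pos ⟨h h1.1, h1.2⟩]
  · rw [if_neg h1]; exact zero_le

lemma one_le_N {S : Set (Idx d)} {f : Fld d} {x : ℝ} {s : Idx d} (hs : s ∈ S) (hx : x < f s) :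
    1 ≤ N S f x := by
  classical
  unfold N
  refine le_trans ?_ (ENNReal.le_tsum s)
  rw [if_pos ⟨hs, hx⟩]

lemma N_scale (S : Set (Idx d)) (f g : Fld d) (x y : ℝ) (c : ℝ) (hc : 0 < c)
    (hf : ∀ s, (g s : ℝ) = c * f s) (hx : y = c * x) : N S g y = N S f x := by
  unfold N
  refine tsum_congr fun s => ?_
  have : (y < (g s : ℝ)) ↔ (x < (f s : ℝ)) := by
    rw [hf, hx]; exact mul_lt_mul_iff_right₀ hc
  classical
  exact if_congr (and_congr_right' this) rfl rfl

lemma N_finset (C : Finset (Idx d)) (f : Fld d) (x : ℝ) :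
    N (C : Set (Idx d)) f x = ∑ s ∈ C, if x < (f s : ℝ) then (1 : ℝ≥0∞) else 0 := by
  classical
  unfold N
  rw [tsum_eq_sum (s := C)]
  · refine Finset.sum_congr rfl fun s hs => ?_
    simp [hs]
  · intro s hs; simp [hs]

/-- kernel -/
noncomputable def K (S : Set (Idx d)) (t : Idx d) (f : Fld d) : ℝ≥0∞ :=
  ∫⁻ v, (N S f (v * f t))⁻¹ ∂U

lemma measurable_integrand (S : Set (Idx d)) (t : Idx d) :
    Measurable (fun p : Fld d × ℝ => (N S p.1 (p.2 * p.1 t))⁻¹) := by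
  refine Measurable.inv ?_
  exact (measurable_N S).comp (f := fun p : Fld d × ℝ => (p.1, p.2 * (p.1 t : ℝ))) (by fun_prop)

lemma measurable_K (S : Set (Idx d)) (t : Idx d) : Measurable (K S t) :=
  (measurable_integrand S t).lintegral_prod_right'

lemma homog_K (S : Set (Idx d)) (t : Idx d) : Homog0 (K S t) := by
  intro c hc f
  unfold K
  congr 1; ext v
  congr 1
  refine N_scale S f _ _ _ (c : ℝ) (by exact_mod_cast hc) (fun s => by simp) ?_
  push_cast; ring

lemma K_shift (S : Set (Idx d)) (t : Idx d) (f : Fld d) :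
    K S t (shift t f) = K {s | s + t ∈ S} 0 f := by
  unfold K
  congr 1; ext v
  congr 1
  unfold N
  rw [← (Equiv.addRight t).tsum_eq]
  refine tsum_congr fun s => ?_
  classical
  refine if_congr ?_ rfl rfl
  simp [shift]

lemma scale_int (φ : ℝ → ℝ≥0∞) (a : ℝ≥0) :
    (a : ℝ≥0∞) * ∫⁻ v, φ (v * a) ∂U = ∫⁻ u in Set.Ioi 0, (if u < (a : ℝ) then 1 else 0) * φ u := by
  have h2 : ∫⁻ u in Set.Ioi 0, (if u < (a : ℝ) then 1 else 0) * φ u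
      = ∫⁻ u in Set.Ioo 0 (a : ℝ), φ u := by
    rw [← lintegral_indicator measurableSet_Ioi, ← lintegral_indicator measurableSet_Ioo]
    congr 1; ext u
    by_cases h1 : 0 < u <;> by_cases h3 : u < (a : ℝ) <;> simp [Set.indicator, h1, h3]
  rw [h2]
  rcases eq_or_lt_of_le (zero_le : 0 ≤ a) with h | h
  · simp [← h]
  · have ha : (0 : ℝ) < a := by exact_mod_cast h
    have himg : (fun v : ℝ => v * a) '' Set.Ioo 0 1 = Set.Ioo 0 (a : ℝ) := by
      rw [Set.image_mul_right_Ioo _ _ ha]; simp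
    rw [← himg, lintegral_image_eq_lintegral_abs_deriv_mul measurableSet_Ioo
      (f' := fun _ => (a : ℝ)) (fun x _ => by
        simpa using ((hasDerivAt_id x).mul_const (a : ℝ)).hasDerivWithinAt)
      (fun x _ y _ hxy => by simpa [ha.ne'] using hxy), lintegral_const_mul' _ _ (by simp)]
    simp [U]

lemma max_eq (C : Finset (Idx d)) (f : Fld d) :
    (⨆ t ∈ C, (f t : ℝ≥0∞)) = ∑ t ∈ C, (f t : ℝ≥0∞) * K C t f := by
  have hm : Measurable (fun u : ℝ => (N (C : Set (Idx d)) f u)⁻¹) :=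
    ((measurable_N _).comp (measurable_const.prodMk measurable_id)).inv
  unfold K
  simp_rw [scale_int (fun u => (N (C : Set (Idx d)) f u)⁻¹)]
  rw [← lintegral_finset_sum _ (fun t _ => by
    refine Measurable.mul (Measurable.ite (measurableSet_lt measurable_id measurable_const)
      measurable_const measurable_const) hm)]
  simp_rw [← Finset.sum_mul, ← N_finset]
  have h : ∀ u : ℝ, 0 < u → N (C : Set (Idx d)) f u * (N (C : Set (Idx d)) f u)⁻¹ =
      (Set.Ioo 0 ((C.sup f : ℝ≥0) : ℝ)).indicator 1 u := by
    intro u hu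
    have key : u < ((C.sup f : ℝ≥0) : ℝ) ↔ ∃ t ∈ C, u < (f t : ℝ) := by
      lift u to ℝ≥0 using hu.le
      simp only [NNReal.coe_lt_coe, Finset.lt_sup_iff]
    by_cases hs : u < ((C.sup f : ℝ≥0) : ℝ)
    · obtain ⟨t, ht, hlt⟩ := key.1 hs
      rw [ENNReal.mul_inv_cancel]
      · simp [hu, hs]
      · exact (lt_of_lt_of_le one_pos (one_le_N (by simpa using ht) hlt)).ne'
      · rw [N_finset]
        refine ENNReal.sum_ne_top.2 fun s _ => ?_
        split_ifs <;> simp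
    · have : N (C : Set (Idx d)) f u = 0 := by
        rw [N_finset]
        refine Finset.sum_eq_zero fun s hs' => if_neg fun hh => hs (key.2 ⟨s, hs', hh⟩)
      simp [this, hs]
  rw [setLIntegral_congr_fun measurableSet_Ioi (fun u hu => h u hu),
    lintegral_indicator_one measurableSet_Ioo, Measure.restrict_apply measurableSet_Ioo,
    Set.inter_eq_left.2 (fun x hx => hx.1), Real.volume_Ioo]
  simp only [sub_zero, ENNReal.ofReal_coe_nnreal]
  rw [ENNReal.coe_finset_sup, Finset.sup_eq_iSup]

variable {Ω : Type*} [MeasurableSpace Ω]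

/-- tilted expectation -/
noncomputable def g (P : Measure Ω) (Z : Ω → Fld d) (S : Set (Idx d)) : ℝ≥0∞ :=
  ∫⁻ ω, (Z ω 0 : ℝ≥0∞) * K S 0 (Z ω) ∂P

lemma g_anti (P : Measure Ω) (Z : Ω → Fld d) {S T : Set (Idx d)} (h : S ⊆ T) :
    g P Z T ≤ g P Z S := by
  unfold g K
  gcongr
  exact N_mono h _ _

lemma integrand_le {S : Set (Idx d)} (h0 : 0 ∈ S) (f : Fld d) {v : ℝ} (hv : v < 1) :
    (f 0 : ℝ≥0∞) * (N S f (v * f 0))⁻¹ ≤ f 0 := by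
  rcases eq_or_lt_of_le (zero_le : 0 ≤ f 0) with h | h
  · simp [← h]
  · have ha : (0 : ℝ) < f 0 := by exact_mod_cast h
    have : 1 ≤ N S f (v * f 0) := one_le_N h0 (by nlinarith)
    calc _ ≤ (f 0 : ℝ≥0∞) * 1 := by gcongr; exact ENNReal.inv_le_one.2 this
      _ = _ := mul_one _

lemma U_ae : ∀ᵐ v ∂U, 0 < v ∧ v < 1 := ae_restrict_mem measurableSet_Ioo

lemma g_le_one {P : Measure Ω} {Z : Ω → Fld d} (hZ : IsBRS P Z) {S : Set (Idx d)} (h0 : 0 ∈ S) :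
    g P Z S ≤ 1 := by
  rw [← hZ.mean_one 0]
  unfold g K
  refine lintegral_mono fun ω => ?_
  rw [← lintegral_const_mul' _ _ (by simp)]
  calc _ ≤ ∫⁻ v, (Z ω 0 : ℝ≥0∞) ∂U := by
        refine lintegral_mono_ae ?_
        filter_upwards [U_ae] with v hv using integrand_le h0 _ hv.2
    _ = _ := by simp

lemma g_eq_prod {P : Measure Ω} [IsProbabilityMeasure P] {Z : Ω → Fld d} (hZ : IsBRS P Z)
    (S : Set (Idx d)) :
    g P Z S = ∫⁻ p, (Z p.1 0 : ℝ≥0∞) * (N S (Z p.1) (p.2 * Z p.1 0))⁻¹ ∂(P.prod U) := by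
  have hm := hZ.meas
  rw [lintegral_prod]
  · unfold g K
    congr 1; ext ω
    rw [← lintegral_const_mul' _ _ (by simp)]
  · refine Measurable.aemeasurable (Measurable.mul (by fun_prop) ?_)
    exact (measurable_integrand S 0).comp (f := fun p : Ω × ℝ => (Z p.1, p.2)) (by fun_prop)

/-- boxes -/
noncomputable def box (d m : ℕ) : Finset (Idx d) := Fintype.piFinset fun _ => Finset.Icc (-(m : ℤ)) m

lemma box_tendsto : Tendsto (box d) atTop atTop := by
  refine tendsto_atTop_finset_of_monotone ?_ ?_
  · intro m n h
    refine Fintype.piFinset_subset _ _ fun _ => Finset.Icc_subset_Icc ?_ ?_ <;> omega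
  · intro t
    refine ⟨∑ j, (t j).natAbs, ?_⟩
    simp only [box, Fintype.mem_piFinset, Finset.mem_Icc]
    intro j
    have : (t j).natAbs ≤ ∑ j, (t j).natAbs :=
      Finset.single_le_sum (f := fun j => (t j).natAbs) (fun _ _ => Nat.zero_le _) (Finset.mem_univ j)
    omega

lemma zero_mem_box (m : ℕ) : (0 : Idx d) ∈ box d m := by simp [box]

lemma g_tendsto {P : Measure Ω} [IsProbabilityMeasure P] {Z : Ω → Fld d} (hZ : IsBRS P Z) :
    Tendsto (fun m => g P Z (box d m)) atTop (nhds (g P Z Set.univ)) := by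
  have hm := hZ.meas
  simp_rw [g_eq_prod hZ]
  refine tendsto_lintegral_of_dominated_convergence (fun p => (Z p.1 0 : ℝ≥0∞)) ?_ ?_ ?_ ?_
  · intro m
    refine Measurable.mul (by fun_prop) ?_
    exact (measurable_integrand _ 0).comp (f := fun p : Ω × ℝ => (Z p.1, p.2)) (by fun_prop)
  · intro m
    have : ∀ᵐ p ∂(P.prod U), 0 < p.2 ∧ p.2 < 1 :=
      Measure.quasiMeasurePreserving_snd.ae U_ae
    filter_upwards [this] with p hp
    exact integrand_le (by simpa using zero_mem_box m) _ hp.2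
  · rw [lintegral_prod _ (by fun_prop)]
    simp [hZ.mean_one 0]
  · refine ae_of_all _ fun p => ?_
    refine ENNReal.Tendsto.const_mul ?_ (Or.inr (by simp))
    refine ENNReal.tendsto_inv_iff.2 ?_
    simp_rw [N_finset]
    have : N Set.univ (Z p.1) (p.2 * Z p.1 0) =
      ∑' s, if p.2 * Z p.1 0 < (Z p.1 s : ℝ) then (1 : ℝ≥0∞) else 0 := by simp [N]
    rw [this]
    exact ENNReal.summable.hasSum.comp box_tendsto

/-- cube as finset -/
noncomputable def cubeF (d n : ℕ) : Finset (Idx d) := Fintype.piFinset fun _ => Finset.Icc (0 : ℤ) n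

lemma mem_cubeF (n : ℕ) (t : Idx d) : t ∈ cubeF d n ↔ ∀ j, 0 ≤ t j ∧ t j ≤ (n : ℤ) := by
  simp [cubeF]

lemma cubeMax_eq {P : Measure Ω} {Z : Ω → Fld d} (hZ : IsBRS P Z) (n : ℕ) :
    cubeMaxExp P Z n = ∑ t ∈ cubeF d n, g P Z {s | s + t ∈ cubeF d n} := by
  have hm := hZ.meas
  have : ∀ ω, (⨆ t ∈ cube d n, (Z ω t : ℝ≥0∞)) =
      ∑ t ∈ cubeF d n, (Z ω t : ℝ≥0∞) * K (cubeF d n) t (Z ω) := by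
    intro ω
    rw [← max_eq]
    simp [mem_cubeF, cube]
  unfold cubeMaxExp
  simp_rw [this]
  rw [lintegral_finset_sum]
  · refine Finset.sum_congr rfl fun t _ => ?_
    rw [hZ.tilt_shift t _ (measurable_K _ t) (homog_K _ t)]
    simp_rw [K_shift]
    rfl
  · intro t _
    exact Measurable.mul (by fun_prop) ((measurable_K _ t).comp hm)

lemma card_cubeF (n : ℕ) : (cubeF d n).card = (n + 1) ^ d := by
  simp [cubeF]

/-- inner cube -/
noncomputable def inner (d n m : ℕ) : Finset (Idx d) := Fintype.piFinset fun _ => Finset.Icc (m : ℤ) (n - m)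

lemma card_inner (n m : ℕ) (h : 2 * m ≤ n) : (inner d n m).card = (n + 1 - 2 * m) ^ d := by
  simp only [inner, Fintype.card_piFinset, Int.card_Icc, Finset.prod_const, Finset.card_univ,
    Fintype.card_fin]
  congr 1; omega

lemma inner_sub (n m : ℕ) : inner d n m ⊆ cubeF d n := by
  refine Fintype.piFinset_subset _ _ fun _ => Finset.Icc_subset_Icc ?_ ?_ <;> omega

lemma lower {P : Measure Ω} {Z : Ω → Fld d} (hZ : IsBRS P Z) (n : ℕ) :
    ((n : ℝ≥0∞)) ^ d * g P Z Set.univ ≤ cubeMaxExp P Z n := by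
  rw [cubeMax_eq hZ]
  calc _ ≤ ((n + 1 : ℕ) : ℝ≥0∞) ^ d * g P Z Set.univ := by gcongr; simp
    _ = ∑ t ∈ cubeF d n, g P Z Set.univ := by
      rw [Finset.sum_const, card_cubeF, nsmul_eq_mul]; push_cast; rfl
    _ ≤ _ := Finset.sum_le_sum fun t _ => g_anti P Z (Set.subset_univ _)

lemma upper {P : Measure Ω} {Z : Ω → Fld d} (hZ : IsBRS P Z) (n m : ℕ) (h : 2 * m ≤ n) :
    cubeMaxExp P Z n ≤ (((n + 1) ^ d : ℕ) : ℝ≥0∞) * g P Z (box d m) +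
      (((n + 1) ^ d - (n + 1 - 2 * m) ^ d : ℕ) : ℝ≥0∞) := by
  classical
  rw [cubeMax_eq hZ, ← Finset.sum_sdiff (inner_sub n m), add_comm]
  gcongr
  · calc _ ≤ ∑ t ∈ inner d n m, g P Z (box d m) := by
          refine Finset.sum_le_sum fun t ht => g_anti P Z ?_
          intro s hs
          simp only [inner, box, Fintype.mem_piFinset, Finset.mem_Icc, Finset.mem_coe] at ht hs
          simp only [Set.mem_setOf_eq, mem_cubeF, Pi.add_apply]
          intro j
          have h1 := ht j
          have h2 := hs j
          omega
      _ ≤ _ := by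
          rw [Finset.sum_const, nsmul_eq_mul, ← card_cubeF]
          gcongr
          exact inner_sub n m
  · calc _ ≤ ∑ t ∈ cubeF d n \ inner d n m, (1 : ℝ≥0∞) := by
          refine Finset.sum_le_sum fun t ht => g_le_one hZ ?_
          simpa using (Finset.mem_sdiff.1 ht).1
      _ = _ := by
          rw [Finset.sum_const, Finset.card_sdiff_of_subset (inner_sub n m), card_cubeF,
            card_inner n m h]
          simp

lemma ratio_tendsto (a : ℝ) : Tendsto (fun n : ℕ => (((n : ℝ) + a) / n) ^ d) atTop (nhds 1) := by
  have : Tendsto (fun n : ℕ => ((n : ℝ) + a) / n) atTop (nhds 1) := by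
    have h := (tendsto_const_div_atTop_nhds_zero_nat a).const_add 1
    rw [add_zero] at h
    refine h.congr' ?_
    filter_upwards [eventually_gt_atTop 0] with n hn
    have : (n : ℝ) ≠ 0 := by positivity
    field_simp
  simpa using this.pow d

lemma limit_eq {P : Measure Ω} [IsProbabilityMeasure P] {Z : Ω → Fld d} (hZ : IsBRS P Z)
    (H : ℝ≥0∞)
    (hH : Tendsto (fun n : ℕ => cubeMaxExp P Z n / (n : ℝ≥0∞) ^ d) atTop (nhds H)) :
    H = g P Z Set.univ := by
  refine le_antisymm ?_ ?_
  · refine ge_of_tendsto' (g_tendsto hZ) fun m => ?_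
    have h1 : Tendsto (fun n : ℕ => ENNReal.ofReal ((((n : ℝ) + 1) / n) ^ d) * g P Z (box d m) +
        ENNReal.ofReal ((((n : ℝ) + 1) / n) ^ d - (((n : ℝ) + (1 - 2 * m)) / n) ^ d)) atTop
        (nhds (ENNReal.ofReal 1 * g P Z (box d m) + ENNReal.ofReal (1 - 1))) := by
      refine Tendsto.add (ENNReal.Tendsto.mul_const
        (ENNReal.tendsto_ofReal (ratio_tendsto 1)) (Or.inl (by simp))) ?_
      exact ENNReal.tendsto_ofReal ((ratio_tendsto 1).sub (ratio_tendsto _))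
    simp only [ENNReal.ofReal_one, one_mul, sub_self, ENNReal.ofReal_zero, add_zero] at h1
    refine le_of_tendsto_of_tendsto hH h1 ?_
    filter_upwards [eventually_gt_atTop (2 * m)] with n hn
    have hn0 : (0 : ℝ) < n := by exact_mod_cast (by omega : 0 < n)
    have hpow : (n : ℝ≥0∞) ^ d = ENNReal.ofReal ((n : ℝ) ^ d) := by
      rw [ENNReal.ofReal_pow hn0.le, ENNReal.ofReal_natCast]
    have hp : (0 : ℝ) < (n : ℝ) ^ d := by positivity
    calc _ ≤ ((((n + 1) ^ d : ℕ) : ℝ≥0∞) * g P Z (box d m) +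
      (((n + 1) ^ d - (n + 1 - 2 * m) ^ d : ℕ) : ℝ≥0∞)) / (n : ℝ≥0∞) ^ d := by
          gcongr; exact upper hZ n m hn.le
      _ = _ := by
          rw [ENNReal.add_div, ENNReal.mul_div_right_comm, hpow]
          congr 2
          · rw [← ENNReal.ofReal_natCast, ← ENNReal.ofReal_div_of_pos hp, div_pow]
            push_cast; rfl
          · rw [← ENNReal.ofReal_natCast, ← ENNReal.ofReal_div_of_pos hp, div_pow, div_pow,
              ← sub_div, Nat.cast_sub (Nat.pow_le_pow_left (by omega) _)]
            push_cast [Nat.cast_sub (show 2 * m ≤ n + 1 by omega)]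
            rw [add_sub_assoc]
  · refine ge_of_tendsto hH ?_
    filter_upwards [eventually_gt_atTop 0] with n hn
    rw [ENNReal.le_div_iff_mul_le (by left; positivity) (by left; simp)]
    rw [mul_comm]
    exact lower hZ n

variable {Ω' : Type*} [MeasurableSpace Ω']

lemma pareto_pos {Q : Measure Ω'} [IsProbabilityMeasure Q] {R : Ω' → ℝ≥0}
    (hR : IsUnitPareto Q R) : ∀ᵐ ω ∂Q, (1 : ℝ) < R ω := by
  have hm := hR.1
  have := hR.2 1 le_rfl
  simp only [inv_one, ENNReal.ofReal_one] at this
  exact (prob_compl_eq_zero_iff (measurableSet_lt (by fun_prop) (by fun_prop))).2 this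

lemma pareto_law {Q : Measure Ω'} [IsProbabilityMeasure Q] {R : Ω' → ℝ≥0}
    (hR : IsUnitPareto Q R) : Q.map (fun ω => ((R ω : ℝ))⁻¹) = U := by
  have hm := hR.1
  have hV : Measurable (fun ω => ((R ω : ℝ))⁻¹) := by fun_prop
  have : IsProbabilityMeasure (Q.map (fun ω => ((R ω : ℝ))⁻¹)) :=
    Measure.isProbabilityMeasure_map hV.aemeasurable
  have hpos := pareto_pos hR
  have key : ∀ y : ℝ, (Q.map (fun ω => ((R ω : ℝ))⁻¹)) (Set.Iio y) = U (Set.Iio y) := by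
    intro y
    rw [Measure.map_apply hV measurableSet_Iio, U, Measure.restrict_apply measurableSet_Iio]
    rcases le_or_gt y 0 with hy | hy
    · have : Set.Iio y ∩ Set.Ioo 0 1 = ∅ := by
        ext x; simp; intros; linarith
      rw [this, measure_empty]
      have : (fun ω => ((R ω : ℝ))⁻¹) ⁻¹' Set.Iio y = ∅ := by
        ext ω; simp; exact hy.trans (by positivity)
      rw [this, measure_empty]
    rcases le_or_gt y 1 with hy1 | hy1
    · have : Set.Iio y ∩ Set.Ioo 0 1 = Set.Ioo 0 y := by
        ext x; simp; constructor
        · rintro ⟨a, b, c⟩; exact ⟨b, a⟩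
        · rintro ⟨a, b⟩; exact ⟨b, a, by linarith⟩
      rw [this, Real.volume_Ioo, sub_zero]
      have h := hR.2 y⁻¹ ((one_le_inv₀ hy).2 hy1)
      rw [inv_inv] at h
      rw [← h]
      refine measure_congr ?_
      filter_upwards [hpos] with ω hω
      refine propext ?_
      change ((R ω : ℝ))⁻¹ < y ↔ y⁻¹ < (R ω : ℝ)
      exact inv_lt_comm₀ (by linarith) hy
    · have : Set.Iio y ∩ Set.Ioo 0 1 = Set.Ioo 0 1 := by
        ext x; simp; intros; linarith
      rw [this, Real.volume_Ioo, sub_zero, ENNReal.ofReal_one]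
      refine (prob_compl_eq_zero_iff (hV measurableSet_Iio)).1 ?_
      change ∀ᵐ ω ∂Q, ((R ω : ℝ))⁻¹ < y
      filter_upwards [hpos] with ω hω
      exact (inv_lt_one_of_one_lt₀ hω).trans hy1
  refine Measure.ext_of_Ici _ _ fun y => ?_
  rw [← Set.compl_Iio, prob_compl_eq_one_sub measurableSet_Iio,
    prob_compl_eq_one_sub measurableSet_Iio, key]

lemma tail_lintegral {P : Measure Ω} {Q : Measure Ω'} {Z : Ω → Fld d} (hZ : IsBRS P Z)
    {Θ : Ω' → Fld d} (hΘ : IsSpectralTail P Z Q Θ) (F : Fld d → ℝ≥0∞) (hF : Measurable F) :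
    ∫⁻ ω, F (Θ ω) ∂Q = ∫⁻ ω, (Z ω 0 : ℝ≥0∞) * F (fun t => Z ω t / Z ω 0) ∂P := by
  have hm := hZ.meas
  have hT : Measurable (fun ω => (fun t => Z ω t / Z ω 0 : Fld d)) := by
    refine measurable_pi_lambda _ fun t => ?_
    exact Measurable.div (by fun_prop) (by fun_prop)
  have hw : Measurable (fun ω => (Z ω 0 : ℝ≥0∞)) := by fun_prop
  have law : Q.map Θ = (P.withDensity (fun ω => (Z ω 0 : ℝ≥0∞))).map
      (fun ω => (fun t => Z ω t / Z ω 0 : Fld d)) := by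
    ext A hA
    rw [Measure.map_apply hΘ.1 hA, hΘ.2 A hA, Measure.map_apply hT hA,
      withDensity_apply _ (hT hA), ← lintegral_indicator (hT hA)]
    congr 1; ext ω
    by_cases h : (fun t => Z ω t / Z ω 0 : Fld d) ∈ A <;> simp [Set.indicator, h]
  rw [← lintegral_map hF hΘ.1, law, lintegral_map hF hT,
    lintegral_withDensity_eq_lintegral_mul _ hw (g := fun ω => F (fun t => Z ω t / Z ω 0))
      (hF.comp hT)]
  rfl

end BRAux

open BRAux in
/-- For `Z` Brown–Resnick stationary with `E[Z(t)] = 1` and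
`max_t Z(t) > 0` a.s., spectral tail field `Θ`, unit Pareto `R` independent of `Θ` and
`Y = R·Θ`, the classical extremal index satisfies
`H_Z = E[ 1 / Σ_{t∈ℤ^d} 1{Y(t) > 1} ]` (with `1/∞ = 0`). -/
theorem stmt7 {d : ℕ} (hd : 0 < d) {Ω Ω' : Type*} [MeasurableSpace Ω] [MeasurableSpace Ω']
    (P : Measure Ω) [IsProbabilityMeasure P] (Q : Measure Ω') [IsProbabilityMeasure Q]
    (Z : Ω → Fld d) (hZ : IsBRS P Z) (hZpos : ∀ᵐ ω ∂P, ∃ t, 0 < Z ω t)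
    (Θ : Ω' → Fld d) (hΘ : IsSpectralTail P Z Q Θ)
    (R : Ω' → ℝ≥0) (hR : IsUnitPareto Q R) (hRΘ : ProbabilityTheory.IndepFun R Θ Q)
    (H : ℝ≥0∞)
    (hH : Tendsto (fun n : ℕ => cubeMaxExp P Z n / (n : ℝ≥0∞) ^ d) atTop (nhds H)) :
    H = ∫⁻ ω, (∑' t : Idx d, if 1 < R ω * Θ ω t then (1 : ℝ≥0∞) else 0)⁻¹ ∂Q := by
  rw [limit_eq hZ H hH]
  have hRm := hR.1
  have hΘm := hΘ.1
  have hV : Measurable (fun ω => ((R ω : ℝ))⁻¹) := by fun_prop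
  have hI : ProbabilityTheory.IndepFun Θ (fun ω => ((R ω : ℝ))⁻¹) Q :=
    (hRΘ.comp (φ := fun r : ℝ≥0 => (r : ℝ)⁻¹) (ψ := id) (by fun_prop) measurable_id).symm
  have hprod := (ProbabilityTheory.indepFun_iff_map_prod_eq_prod_map_map
    hΘm.aemeasurable hV.aemeasurable).1 hI
  rw [pareto_law hR] at hprod
  have hNm : Measurable (fun p : Fld d × ℝ => (N Set.univ p.1 p.2)⁻¹) := (measurable_N _).inv
  have : IsProbabilityMeasure (Q.map Θ) := Measure.isProbabilityMeasure_map hΘm.aemeasurable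
  symm
  calc _ = ∫⁻ ω, (N Set.univ (Θ ω) ((R ω : ℝ))⁻¹)⁻¹ ∂Q := by
        refine lintegral_congr_ae ?_
        filter_upwards [pareto_pos hR] with ω hω
        have hr : (0 : ℝ) < R ω := by linarith
        congr 1
        unfold N
        refine tsum_congr fun t => ?_
        have : (1 < R ω * Θ ω t) ↔ (t ∈ Set.univ ∧ ((R ω : ℝ))⁻¹ < (Θ ω t : ℝ)) := by
          rw [← NNReal.coe_lt_coe]
          push_cast
          simp only [Set.mem_univ, true_and]
          exact (inv_lt_iff_one_lt_mul₀' hr).symm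
        by_cases hc : 1 < R ω * Θ ω t
        · rw [if_pos hc, if_pos (this.1 hc)]
        · rw [if_neg hc, if_neg (fun h => hc (this.2 h))]
    _ = ∫⁻ p, (N Set.univ p.1 p.2)⁻¹ ∂((Q.map Θ).prod U) := by
        rw [← hprod, lintegral_map hNm (hΘm.prodMk hV)]
    _ = ∫⁻ ω, (∫⁻ v, (N Set.univ (Θ ω) v)⁻¹ ∂U) ∂Q := by
        rw [lintegral_prod _ hNm.aemeasurable, lintegral_map hNm.lintegral_prod_right' hΘm]
    _ = _ := by
        rw [tail_lintegral hZ hΘ (fun f => ∫⁻ v, (N Set.univ f v)⁻¹ ∂U)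
          hNm.lintegral_prod_right']
        unfold g K
        congr 1; ext ω
        rcases eq_or_lt_of_le (zero_le : 0 ≤ Z ω 0) with h | h
        · simp [← h]
        · have ha : (0 : ℝ) < Z ω 0 := by exact_mod_cast h
          congr 2; ext v
          congr 1
          symm
          refine N_scale _ _ _ _ _ (Z ω 0 : ℝ) ha (fun s => ?_) (mul_comm _ _)
          push_cast
          field_simp
end
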